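/- arXiv:1302.2043 — 3 statements merged into one kernel-verified Lean document; each statement's English description precedes it below -/
import Mathlib

section
/- Let s ≥ 1, let θ⁰ ∈ ℓ²(ℤ;ℂ) satisfy Q_s := (Σ_{k∈ℤ} |k|^{2s} |θ⁰_k|²)^{1/2} < ∞, and let g⁰ be a Borel probability measure on [0,1]. Then there exist constants C₀ > 0, C > 0 and ε₀ ∈ (0,1), depending only on s and Q_s, such that for every ε ∈ (0, ε₀] the following holds with ℓ := ⌈ε^{−1/s}⌉ and η := ε²: there exist an integer J ≤ C ℓ², points ψ_1, …, ψ_J ∈ [0,1] satisfying |ψ_i − ψ_j| ≥ η for i ≠ j, and weights p_1, …, p_J ≥ 0 with Σ_j p_j = 1, such that for every Borel probability measure g on [0,1] with Σ_{j=1}^J | g([ψ_j − η/2, ψ_j + η/2]) − p_j | ≤ ε², and every θ ∈ ℓ²(ℤ;ℂ) with θ_k = 0 for |k| > ℓ and ‖θ − θ⁰_ℓ‖ ≤ ε², one has d_H( P_{θ⁰,g⁰}, P_{θ,g} ) ≤ C₀ ε, where θ⁰_ℓ is the truncation of θ⁰ to frequencies |k| ≤ ℓ. -/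
open MeasureTheory Real Set

/-- the standard complex Gaussian probability measure N_ℂ(μ,1) on ℂ,
with Lebesgue density z ↦ π⁻¹ e^{−|z−μ|²} -/
noncomputable def gaussC (μ : ℂ) : Measure ℂ :=
  volume.withDensity (fun z => ENNReal.ofReal (Real.pi⁻¹ * Real.exp (-‖z - μ‖ ^ 2)))

/-- the rotated sequence (θ•φ)_k = θ_k e^{−2iπkφ} -/
noncomputable def rotZ (θ : ℤ → ℂ) (φ : ℝ) : ℤ → ℂ :=
  fun k => θ k * Complex.exp (-Complex.I * (2 * Real.pi * (k : ℝ) * φ))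

/-- `P` is the product measure ⊗_{k∈ℤ} N_ℂ(θ_k e^{−2iπkφ}, 1) on ℂ^ℤ (product σ-algebra),
characterized as the projective limit of its finite-dimensional Gaussian product marginals. -/
def IsGaussProduct (θ : ℤ → ℂ) (φ : ℝ) (P : Measure (ℤ → ℂ)) : Prop :=
  IsProbabilityMeasure P ∧
    IsProjectiveLimit P (fun J : Finset ℤ => Measure.pi (fun k : J => gaussC (rotZ θ φ k)))

/-- g is a Borel probability measure on [0,1] (encoded as a measure on ℝ carried by [0,1]) -/
def IsProbOn01 (g : MeasureTheory.Measure ℝ) : Prop :=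
  MeasureTheory.IsProbabilityMeasure g ∧ g (Set.Icc 0 1) = 1

/-- `P` is the mixture P_{θ,g}(A) = ∫₀¹ (⊗_{k∈ℤ} N_ℂ(θ_k e^{−2iπkφ},1))(A) dg(φ) on ℂ^ℤ. -/
def IsMixtureLaw (θ : ℤ → ℂ) (g : Measure ℝ) (P : Measure (ℤ → ℂ)) : Prop :=
  ∃ Pp : ℝ → Measure (ℤ → ℂ), (∀ φ : ℝ, IsGaussProduct θ φ (Pp φ)) ∧
    ∀ A : Set (ℤ → ℂ), MeasurableSet A → P A = ∫⁻ φ, Pp φ A ∂g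

/-- Hellinger distance between two measures (computed through densities with respect to
the dominating measure P + Q; it does not depend on this choice). -/
noncomputable def dH {X : Type*} [MeasurableSpace X] (P Q : Measure X) : ℝ :=
  Real.sqrt (∫ x, (Real.sqrt ((P.rnDeriv (P + Q) x).toReal)
      - Real.sqrt ((Q.rnDeriv (P + Q) x).toReal)) ^ 2 ∂(P + Q))

/-- total variation distance between two measures: sup over measurable sets A of |P(A) − Q(A)| -/
noncomputable def dTV {X : Type*} [MeasurableSpace X] (P Q : Measure X) : ℝ :=
  ⨆ (A : Set X) (_ : MeasurableSet A), |(P A).toReal - (Q A).toReal|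

/-- the ℓ²(ℤ) norm of a sequence -/
noncomputable def l2norm (θ : ℤ → ℂ) : ℝ := Real.sqrt (∑' k : ℤ, ‖θ k‖ ^ 2)

/-- truncation of a sequence to the frequencies |k| ≤ ℓ -/
noncomputable def trunc (θ : ℤ → ℂ) (ℓ : ℕ) : ℤ → ℂ :=
  fun k => if |k| ≤ (ℓ : ℤ) then θ k else 0

instance isProbabilityMeasure_gaussC (μ : ℂ) : IsProbabilityMeasure (gaussC μ) := by
  have h1 : ∫ z : ℂ, π⁻¹ * rexp (-‖z - μ‖ ^ 2) = 1 := by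
    rw [integral_sub_right_eq_self (fun z : ℂ => π⁻¹ * rexp (-‖z‖ ^ 2)) μ, integral_const_mul]
    have := GaussianFourier.integral_rexp_neg_mul_sq_norm (V := ℂ) (b := 1) one_pos
    simp only [neg_mul, one_mul, div_one, Complex.finrank_real_complex] at this
    rw [this]
    norm_num
  refine ⟨?_⟩
  rw [gaussC, withDensity_apply _ MeasurableSet.univ, Measure.restrict_univ,
    ← ofReal_integral_eq_lintegral_ofReal, h1, ENNReal.ofReal_one]
  · by_contra h
    rw [integral_undef h] at h1
    exact zero_ne_one h1
  · exact Filter.Eventually.of_forall fun z => by positivity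

lemma gaussC_eq_withDensity_gaussC (c m : ℂ) :
    gaussC m = (gaussC c).withDensity
      (fun z => ENNReal.ofReal (rexp (‖z - c‖ ^ 2 - ‖z - m‖ ^ 2))) := by
  unfold gaussC
  rw [← withDensity_mul _ (by fun_prop) (by fun_prop)]
  congr 1
  ext z
  rw [Pi.mul_apply, ← ENNReal.ofReal_mul (by positivity), mul_assoc, ← Real.exp_add]
  ring_nf

section FiniteProduct

variable {ι : Type*} [Fintype ι]

/-- The product of the standard complex Gaussian measures centred at the entries of `c`. -/
noncomputable def gaussPi (c : ι → ℂ) : Measure (ι → ℂ) := Measure.pi fun i => gaussC (c i)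

/-- The density of `gaussPi m` with respect to `gaussPi c`. -/
noncomputable def gaussRatio (c m z : ι → ℂ) : ℝ :=
  rexp (∑ i, (‖z i - c i‖ ^ 2 - ‖z i - m i‖ ^ 2))

instance (c : ι → ℂ) : IsProbabilityMeasure (gaussPi c) := by
  unfold gaussPi; infer_instance

lemma gaussRatio_pos (c m z : ι → ℂ) : 0 < gaussRatio c m z := exp_pos _

lemma continuous_gaussRatio {X : Type*} [TopologicalSpace X] (c : ι → ℂ) {f g : X → ι → ℂ}
    (hf : Continuous f) (hg : Continuous g) :
    Continuous fun x => gaussRatio c (f x) (g x) := by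
  have h1 : ∀ i, Continuous fun x => f x i := fun i => (continuous_apply i).comp hf
  have h2 : ∀ i, Continuous fun x => g x i := fun i => (continuous_apply i).comp hg
  unfold gaussRatio
  exact Real.continuous_exp.comp <| continuous_finsetSum _ fun i _ =>
    (((h2 i).sub continuous_const).norm.pow 2).sub (((h2 i).sub (h1 i)).norm.pow 2)

lemma gaussRatio_le (c m z : ι → ℂ) : gaussRatio c m z ≤ rexp (∑ i, ‖z i - c i‖ ^ 2) :=
  exp_le_exp.2 <| Finset.sum_le_sum fun i _ => by nlinarith [sq_nonneg ‖z i - m i‖]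

lemma gaussPi_eq_withDensity (c m : ι → ℂ) :
    gaussPi m = (gaussPi c).withDensity fun z => ENNReal.ofReal (gaussRatio c m z) := by
  refine Measure.pi_eq fun s hs => ?_
  rw [withDensity_apply _ (MeasurableSet.univ_pi hs), ← lintegral_indicator (.univ_pi hs)]
  let X : ι → ℂ → ENNReal := fun i =>
    (s i).indicator fun z => ENNReal.ofReal (rexp (‖z - c i‖ ^ 2 - ‖z - m i‖ ^ 2))
  have hX : ∀ i, Measurable (X i) := fun i => Measurable.indicator (by fun_prop) (hs i)
  have h1 : ∀ z : ι → ℂ, (univ.pi s).indicator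
      (fun z => ENNReal.ofReal (gaussRatio c m z)) z = ∏ i, X i (z i) := by
    intro z
    by_cases hz : z ∈ univ.pi s
    · rw [indicator_of_mem hz, gaussRatio, Real.exp_sum, ENNReal.ofReal_prod_of_nonneg
        (fun _ _ => (exp_pos _).le)]
      exact Finset.prod_congr rfl fun i _ => (indicator_of_mem (hz i trivial) (f := fun z =>
        ENNReal.ofReal (rexp (‖z - c i‖ ^ 2 - ‖z - m i‖ ^ 2)))).symm
    · rw [indicator_of_notMem hz]
      simp only [mem_pi, mem_univ, true_implies, not_forall] at hz
      obtain ⟨i, hi⟩ := hz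
      exact (Finset.prod_eq_zero (Finset.mem_univ i) (indicator_of_notMem hi _)).symm
  simp_rw [h1]
  have h2 := ProbabilityTheory.lintegral_prod_eq_prod_lintegral_of_indepFun Finset.univ
    (fun i (z : ι → ℂ) => X i (z i))
    (ProbabilityTheory.iIndepFun_pi (μ := fun i => gaussC (c i)) fun i => (hX i).aemeasurable)
    fun i => (hX i).comp (measurable_pi_apply i)
  rw [gaussPi, h2]
  refine Finset.prod_congr rfl fun i _ => ?_
  rw [(measurePreserving_eval (fun i => gaussC (c i)) i).lintegral_comp (hX i),
    lintegral_indicator (hs i), gaussC_eq_withDensity_gaussC (c i) (m i),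
    withDensity_apply _ (hs i)]

lemma lintegral_gaussRatio (c m : ι → ℂ) :
    ∫⁻ z, ENNReal.ofReal (gaussRatio c m z) ∂gaussPi c = 1 := by
  rw [← setLIntegral_univ, ← withDensity_apply _ .univ, ← gaussPi_eq_withDensity, measure_univ]

lemma integrable_gaussRatio (c m : ι → ℂ) : Integrable (gaussRatio c m) (gaussPi c) := by
  refine ⟨(continuous_gaussRatio c continuous_const continuous_id).aestronglyMeasurable, ?_⟩
  rw [hasFiniteIntegral_iff_ofReal (.of_forall fun z => (gaussRatio_pos c m z).le),
    lintegral_gaussRatio]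
  exact ENNReal.one_lt_top

lemma integral_gaussRatio (c m : ι → ℂ) : ∫ z, gaussRatio c m z ∂gaussPi c = 1 := by
  rw [integral_eq_lintegral_of_nonneg_ae (.of_forall fun z => (gaussRatio_pos c m z).le)
    (continuous_gaussRatio c continuous_const continuous_id).aestronglyMeasurable,
    lintegral_gaussRatio, ENNReal.toReal_one]

lemma sqrt_gaussRatio_mul (c m m' z : ι → ℂ) :
    √(gaussRatio c m z) * √(gaussRatio c m' z) =
      gaussRatio c (fun i => (m i + m' i) / 2) z * rexp (-(∑ i, ‖m i - m' i‖ ^ 2) / 4) := by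
  unfold gaussRatio
  rw [Real.sqrt_eq_rpow, Real.sqrt_eq_rpow, ← Real.exp_mul, ← Real.exp_mul, ← Real.exp_add,
    ← Real.exp_add, neg_div, Finset.sum_div, ← sub_eq_add_neg, ← Finset.sum_sub_distrib,
    Finset.sum_mul, Finset.sum_mul, ← Finset.sum_add_distrib]
  congr 1
  refine Finset.sum_congr rfl fun i _ => ?_
  simp only [Complex.sq_norm, Complex.normSq_apply, Complex.sub_re, Complex.sub_im,
    Complex.div_ofNat_re, Complex.div_ofNat_im, Complex.add_re, Complex.add_im]
  ring

lemma gaussRatio_mul (c m m' z : ι → ℂ) :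
    gaussRatio c m z * gaussRatio c m' z = gaussRatio c (fun i => m i + m' i - c i) z *
      rexp (2 * ∑ i, ((m i - c i) * (starRingEnd ℂ) (m' i - c i)).re) := by
  unfold gaussRatio
  rw [← Real.exp_add, ← Real.exp_add, Finset.mul_sum, ← Finset.sum_add_distrib,
    ← Finset.sum_add_distrib]
  congr 1
  refine Finset.sum_congr rfl fun i _ => ?_
  simp only [Complex.sq_norm, Complex.normSq_apply, Complex.sub_re, Complex.sub_im,
    Complex.add_re, Complex.add_im, Complex.mul_re, Complex.conj_re, Complex.conj_im]
  ring

lemma integrable_sqrt_sub_sq {α : Type*} [MeasurableSpace α] {μ : Measure α} {f h : α → ℝ}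
    (hf : Integrable f μ) (hh : Integrable h μ) (hf0 : 0 ≤ f) (hh0 : 0 ≤ h) :
    Integrable (fun z => (√(f z) - √(h z)) ^ 2) μ := by
  refine (hf.add hh).mono' ?_ (.of_forall fun z => ?_)
  · exact ((continuous_sqrt.comp_aestronglyMeasurable hf.1).sub
      (continuous_sqrt.comp_aestronglyMeasurable hh.1)).pow 2
  · rw [Real.norm_of_nonneg (sq_nonneg _), Pi.add_apply]
    nlinarith [sq_sqrt (hf0 z), sq_sqrt (hh0 z), sqrt_nonneg (f z), sqrt_nonneg (h z),
      mul_nonneg (sqrt_nonneg (f z)) (sqrt_nonneg (h z))]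

lemma integral_sqrt_gaussRatio_sub_sq_le (c m m' : ι → ℂ) :
    ∫ z, (√(gaussRatio c m z) - √(gaussRatio c m' z)) ^ 2 ∂gaussPi c ≤
      (∑ i, ‖m i - m' i‖ ^ 2) / 2 := by
  have h : ∀ z, (√(gaussRatio c m z) - √(gaussRatio c m' z)) ^ 2 =
      gaussRatio c m z + gaussRatio c m' z - 2 * (gaussRatio c (fun i => (m i + m' i) / 2) z *
        rexp (-(∑ i, ‖m i - m' i‖ ^ 2) / 4)) := by
    intro z
    rw [← sqrt_gaussRatio_mul]
    nlinarith [sq_sqrt (gaussRatio_pos c m z).le, sq_sqrt (gaussRatio_pos c m' z).le]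
  have hadd : Integrable (fun z => gaussRatio c m z + gaussRatio c m' z) (gaussPi c) :=
    (integrable_gaussRatio c m).add (integrable_gaussRatio c m')
  simp_rw [h]
  rw [integral_sub hadd
    (((integrable_gaussRatio _ _).mul_const _).const_mul _),
    integral_add (integrable_gaussRatio _ _) (integrable_gaussRatio _ _), integral_const_mul,
    integral_mul_const]
  simp only [integral_gaussRatio]
  linarith [Real.add_one_le_exp (-(∑ i, ‖m i - m' i‖ ^ 2) / 4)]

lemma abs_sub_le_sqrt_sub_sq {a b δ : ℝ} (ha : 0 ≤ a) (hb : 0 ≤ b) (hδ : 0 < δ) :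
    |a - b| ≤ (√a - √b) ^ 2 / (2 * δ) + δ * (a + b) := by
  obtain ⟨x, hx, rfl⟩ : ∃ x, 0 ≤ x ∧ x ^ 2 = a := ⟨√a, sqrt_nonneg _, sq_sqrt ha⟩
  obtain ⟨y, hy, rfl⟩ : ∃ y, 0 ≤ y ∧ y ^ 2 = b := ⟨√b, sqrt_nonneg _, sq_sqrt hb⟩
  rw [sqrt_sq hx, sqrt_sq hy, sq_sub_sq, abs_mul, abs_of_nonneg (add_nonneg hx hy)]
  rw [div_add' _ _ _ (by positivity), le_div_iff₀ (by positivity)]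
  nlinarith [sq_nonneg (|x - y| - δ * (x + y)), sq_abs (x - y),
    mul_nonneg hδ.le (sq_nonneg (x - y)), sq_nonneg (δ * (x - y))]

lemma integral_abs_gaussRatio_sub_le (c m m' : ι → ℂ) {r : ℝ} (hr : 0 ≤ r)
    (h : ∑ i, ‖m i - m' i‖ ^ 2 ≤ r ^ 2) :
    ∫ z, |gaussRatio c m z - gaussRatio c m' z| ∂gaussPi c ≤ 3 * r := by
  rcases hr.eq_or_lt with rfl | hr
  · have : m = m' := by
      ext i
      have h0 : ∑ i, ‖m i - m' i‖ ^ 2 = 0 := le_antisymm (by simpa using h) (by positivity)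
      rw [Finset.sum_eq_zero_iff_of_nonneg (fun _ _ => by positivity)] at h0
      simpa [sub_eq_zero] using h0 i
    simp [this]
  have hi := integrable_sqrt_sub_sq (integrable_gaussRatio c m) (integrable_gaussRatio c m')
    (fun z => (gaussRatio_pos c m z).le) (fun z => (gaussRatio_pos c m' z).le)
  have hadd : Integrable (fun z => r * (gaussRatio c m z + gaussRatio c m' z)) (gaussPi c) :=
    ((integrable_gaussRatio c m).add (integrable_gaussRatio c m')).const_mul r
  calc _ ≤ ∫ z, ((√(gaussRatio c m z) - √(gaussRatio c m' z)) ^ 2 / (2 * r) +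
        r * (gaussRatio c m z + gaussRatio c m' z)) ∂gaussPi c :=
        integral_mono ((integrable_gaussRatio c m).sub (integrable_gaussRatio c m')).abs
          ((hi.div_const _).add hadd)
          fun z => abs_sub_le_sqrt_sub_sq (gaussRatio_pos c m z).le (gaussRatio_pos c m' z).le hr
    _ ≤ r ^ 2 / 2 / (2 * r) + r * (1 + 1) := by
        rw [integral_add (hi.div_const _) hadd, integral_div, integral_const_mul,
            integral_add (integrable_gaussRatio _ _) (integrable_gaussRatio _ _)]
        simp only [integral_gaussRatio]
        gcongr
        exact (integral_sqrt_gaussRatio_sub_sq_le c m m').trans (by gcongr)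
    _ ≤ 3 * r := by
        have : r ^ 2 / 2 / (2 * r) = r / 4 := by field_simp; norm_num
        linarith

end FiniteProduct

section Mixture

variable {ι : Type*} [Fintype ι]

/-- The density, with respect to `gaussPi c`, of the mixture of the measures `gaussPi (m φ)`. -/
noncomputable def mixDensity (c : ι → ℂ) (m : ℝ → ι → ℂ) (g : Measure ℝ) (z : ι → ℂ) : ℝ :=
  ∫ φ, gaussRatio c (m φ) z ∂g

lemma integrable_gaussRatio_curve (c : ι → ℂ) {m : ℝ → ι → ℂ} (hm : Continuous m)
    (g : Measure ℝ) [IsFiniteMeasure g] (z : ι → ℂ) :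
    Integrable (fun φ => gaussRatio c (m φ) z) g :=
  Integrable.of_bound (continuous_gaussRatio c hm continuous_const).aestronglyMeasurable
    (rexp (∑ i, ‖z i - c i‖ ^ 2)) <| .of_forall fun φ => by
      rw [Real.norm_of_nonneg (gaussRatio_pos _ _ _).le]; exact gaussRatio_le c _ z

lemma integrable_prod_gaussRatio (c : ι → ℂ) {m : ℝ → ι → ℂ} (hm : Continuous m)
    (g : Measure ℝ) [IsProbabilityMeasure g] :
    Integrable (fun x : (ι → ℂ) × ℝ => gaussRatio c (m x.2) x.1) ((gaussPi c).prod g) := by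
  have hc : Continuous fun x : (ι → ℂ) × ℝ => gaussRatio c (m x.2) x.1 :=
    continuous_gaussRatio c (hm.comp continuous_snd) continuous_fst
  rw [integrable_prod_iff' hc.aestronglyMeasurable]
  refine ⟨.of_forall fun φ => integrable_gaussRatio c (m φ), ?_⟩
  simp_rw [Real.norm_of_nonneg (gaussRatio_pos _ _ _).le, integral_gaussRatio]
  exact integrable_const _

lemma integrable_mixDensity (c : ι → ℂ) {m : ℝ → ι → ℂ} (hm : Continuous m)
    (g : Measure ℝ) [IsProbabilityMeasure g] : Integrable (mixDensity c m g) (gaussPi c) :=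
  (integrable_prod_gaussRatio c hm g).integral_prod_left

lemma mixDensity_pos (c : ι → ℂ) {m : ℝ → ι → ℂ} (hm : Continuous m)
    (g : Measure ℝ) [IsProbabilityMeasure g] (z : ι → ℂ) : 0 < mixDensity c m g z := by
  rw [mixDensity, integral_pos_iff_support_of_nonneg (fun φ => (gaussRatio_pos _ _ _).le)
    (integrable_gaussRatio_curve c hm g z),
    Function.support_eq_univ fun φ => (gaussRatio_pos c (m φ) z).ne']
  simp

lemma measurable_mixDensity (c : ι → ℂ) {m : ℝ → ι → ℂ} (hm : Continuous m)
    (g : Measure ℝ) [IsProbabilityMeasure g] : Measurable (mixDensity c m g) :=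
  (continuous_gaussRatio c (hm.comp continuous_snd)
    continuous_fst).stronglyMeasurable.integral_prod_right.measurable

lemma lintegral_gaussPi_apply (c : ι → ℂ) {m : ℝ → ι → ℂ} (hm : Continuous m)
    (g : Measure ℝ) [IsProbabilityMeasure g] {B : Set (ι → ℂ)} (hB : MeasurableSet B) :
    ∫⁻ φ, gaussPi (m φ) B ∂g =
      (gaussPi c).withDensity (fun z => ENNReal.ofReal (mixDensity c m g z)) B := by
  have hmeas : Measurable fun x : ℝ × (ι → ℂ) => ENNReal.ofReal (gaussRatio c (m x.1) x.2) :=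
    (continuous_gaussRatio c (hm.comp continuous_fst) continuous_snd).measurable.ennreal_ofReal
  simp_rw [gaussPi_eq_withDensity c (m _), withDensity_apply _ hB]
  rw [lintegral_lintegral_swap hmeas.aemeasurable]
  refine lintegral_congr fun z => ?_
  rw [mixDensity, ofReal_integral_eq_lintegral_ofReal (integrable_gaussRatio_curve c hm g z)
    (.of_forall fun φ => (gaussRatio_pos _ _ _).le)]

lemma sqrt_integral_sub_sq_le {α : Type*} [MeasurableSpace α] {μ : Measure α} {a b : α → ℝ}
    (ha : Integrable a μ) (hb : Integrable b μ) (ha0 : 0 ≤ a) (hb0 : 0 ≤ b)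
    (hA : 0 < ∫ x, a x ∂μ) (hB : 0 < ∫ x, b x ∂μ) :
    (√(∫ x, a x ∂μ) - √(∫ x, b x ∂μ)) ^ 2 ≤ ∫ x, (√(a x) - √(b x)) ^ 2 ∂μ := by
  set A := √(∫ x, a x ∂μ)
  set B := √(∫ x, b x ∂μ)
  have hA' : 0 < A := sqrt_pos.2 hA
  have hB' : 0 < B := sqrt_pos.2 hB
  have hAA : ∫ x, a x ∂μ = A ^ 2 := (sq_sqrt hA.le).symm
  have hBB : ∫ x, b x ∂μ = B ^ 2 := (sq_sqrt hB.le).symm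
  calc (A - B) ^ 2 = ∫ x, ((1 - B / A) * a x + (1 - A / B) * b x) ∂μ := by
        rw [integral_add (ha.const_mul _) (hb.const_mul _), integral_const_mul,
          integral_const_mul, hAA, hBB]
        field_simp
        ring
    _ ≤ _ := by
        refine integral_mono ((ha.const_mul _).add (hb.const_mul _))
          (integrable_sqrt_sub_sq ha hb ha0 hb0) fun x => ?_
        have key : 0 ≤ (B * √(a x) - A * √(b x)) ^ 2 / (A * B) := by positivity
        have hx := sq_sqrt (ha0 x)
        have hy := sq_sqrt (hb0 x)
        generalize √(a x) = p at *
        generalize √(b x) = q at *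
        simp only [← hx, ← hy]
        have : (B * p - A * q) ^ 2 / (A * B) = B / A * p ^ 2 + A / B * q ^ 2 - 2 * p * q := by
          field_simp
          ring
        nlinarith

lemma integral_sqrt_mixDensity_sub_sq_le (c : ι → ℂ) {m m' : ℝ → ι → ℂ} (hm : Continuous m)
    (hm' : Continuous m') (g : Measure ℝ) [IsProbabilityMeasure g] {r : ℝ}
    (h : ∀ φ, ∑ i, ‖m φ i - m' φ i‖ ^ 2 ≤ r) :
    ∫ z, (√(mixDensity c m g z) - √(mixDensity c m' g z)) ^ 2 ∂gaussPi c ≤ r / 2 := by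
  have hi := integrable_sqrt_sub_sq (integrable_prod_gaussRatio c hm g)
    (integrable_prod_gaussRatio c hm' g) (fun x => (gaussRatio_pos _ _ _).le)
    (fun x => (gaussRatio_pos _ _ _).le)
  calc _ ≤ ∫ z, ∫ φ, (√(gaussRatio c (m φ) z) - √(gaussRatio c (m' φ) z)) ^ 2 ∂g ∂gaussPi c := by
        refine integral_mono (integrable_sqrt_sub_sq (integrable_mixDensity c hm g)
          (integrable_mixDensity c hm' g) (fun z => (mixDensity_pos c hm g z).le)
          (fun z => (mixDensity_pos c hm' g z).le)) hi.integral_prod_left fun z => ?_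
        exact sqrt_integral_sub_sq_le (integrable_gaussRatio_curve c hm g z)
          (integrable_gaussRatio_curve c hm' g z) (fun x => (gaussRatio_pos _ _ _).le)
          (fun x => (gaussRatio_pos _ _ _).le) (mixDensity_pos c hm g z) (mixDensity_pos c hm' g z)
    _ = ∫ φ, ∫ z, (√(gaussRatio c (m φ) z) - √(gaussRatio c (m' φ) z)) ^ 2 ∂gaussPi c ∂g :=
        integral_integral_swap hi
    _ ≤ ∫ _, r / 2 ∂g := by
        refine integral_mono hi.integral_prod_right (integrable_const _) fun φ => ?_
        exact (integral_sqrt_gaussRatio_sub_sq_le c _ _).trans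
          (div_le_div_of_nonneg_right (h φ) zero_le_two)
    _ = r / 2 := by simp

lemma integral_mul_mixDensity (c : ι → ℂ) {m : ℝ → ι → ℂ} (hm : Continuous m)
    (g : Measure ℝ) [IsProbabilityMeasure g] {u : (ι → ℂ) → ℝ} (hu : Measurable u)
    (hu1 : ∀ z, |u z| ≤ 1) :
    ∫ z, u z * mixDensity c m g z ∂gaussPi c =
      ∫ φ, ∫ z, u z * gaussRatio c (m φ) z ∂gaussPi c ∂g := by
  simp_rw [mixDensity, ← integral_const_mul]
  exact integral_integral_swap (f := fun z φ => u z * gaussRatio c (m φ) z)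
    ((integrable_prod_gaussRatio c hm g).bdd_mul
    (hu.comp measurable_fst).aestronglyMeasurable (c := 1) (.of_forall fun x => hu1 x.1))

lemma integral_abs_mixDensity_sub_le (c : ι → ℂ) {m : ℝ → ι → ℂ} (hm : Continuous m)
    (g g' : Measure ℝ) [IsProbabilityMeasure g] [IsProbabilityMeasure g'] {δ : ℝ}
    (h : ∀ u : (ι → ℂ) → ℝ, Measurable u → (∀ z, |u z| ≤ 1) →
      ∫ φ, ∫ z, u z * gaussRatio c (m φ) z ∂gaussPi c ∂g -
        ∫ φ, ∫ z, u z * gaussRatio c (m φ) z ∂gaussPi c ∂g' ≤ δ) :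
    ∫ z, |mixDensity c m g z - mixDensity c m g' z| ∂gaussPi c ≤ δ := by
  classical
  let u : (ι → ℂ) → ℝ := fun z => if mixDensity c m g' z ≤ mixDensity c m g z then 1 else -1
  have hu : Measurable u := Measurable.ite
    (measurableSet_le (measurable_mixDensity c hm g') (measurable_mixDensity c hm g))
    measurable_const measurable_const
  have hu1 : ∀ z, |u z| ≤ 1 := fun z => by simp only [u]; split_ifs <;> simp
  refine le_trans (le_of_eq ?_) (h u hu hu1)
  have hi : ∀ g : Measure ℝ, ∀ [IsProbabilityMeasure g],
      Integrable (fun z => u z * mixDensity c m g z) (gaussPi c) := fun g _ =>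
    (integrable_mixDensity c hm g).bdd_mul hu.aestronglyMeasurable (c := 1) (.of_forall hu1)
  rw [← integral_mul_mixDensity c hm g hu hu1, ← integral_mul_mixDensity c hm g' hu hu1,
    ← integral_sub (hi g) (hi g')]
  refine integral_congr_ae (.of_forall fun z => ?_)
  simp only [u]
  split_ifs with hz
  · rw [abs_of_nonneg (sub_nonneg.2 hz)]; ring
  · rw [abs_of_nonpos (by linarith)]; ring

end Mixture

section HellingerLimit

variable {X Y : Type*} [mX : MeasurableSpace X] [mY : MeasurableSpace Y]

lemma map_add_eq_withDensity {P Q : Measure X} {T : X → Y} (hT : Measurable T) {γ : Measure Y}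
    {f h : Y → ℝ} (hf : Measurable f) (hf0 : ∀ y, 0 < f y) (hh0 : ∀ y, 0 < h y)
    (hP : P.map T = γ.withDensity fun y => ENNReal.ofReal (f y))
    (hQ : Q.map T = γ.withDensity fun y => ENNReal.ofReal (h y)) :
    (P + Q).map T = γ.withDensity fun y => ENNReal.ofReal (f y + h y) := by
  rw [Measure.map_add _ _ hT, hP, hQ, ← withDensity_add_left hf.ennreal_ofReal]
  congr 1
  ext y
  rw [Pi.add_apply, ENNReal.ofReal_add (hf0 y).le (hh0 y).le]

lemma condExp_rnDeriv_comap_ae_eq {P Q : Measure X} [IsFiniteMeasure P] [IsFiniteMeasure Q]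
    {T : X → Y} (hT : Measurable T) {γ : Measure Y} {f h : Y → ℝ}
    (hf : Measurable f) (hh : Measurable h) (hf0 : ∀ y, 0 < f y) (hh0 : ∀ y, 0 < h y)
    (hP : P.map T = γ.withDensity fun y => ENNReal.ofReal (f y))
    (hQ : Q.map T = γ.withDensity fun y => ENNReal.ofReal (h y)) :
    (P + Q)[fun x => (P.rnDeriv (P + Q) x).toReal | mY.comap T] =ᵐ[P + Q]
      fun x => f (T x) / (f (T x) + h (T x)) := by
  have hm : mY.comap T ≤ mX := hT.comap_le
  have hmap := map_add_eq_withDensity hT hf hf0 hh0 hP hQ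
  have hfh : Measurable fun y => f y + h y := hf.add hh
  have hr : Measurable fun y => f y / (f y + h y) := hf.div (hf.add hh)
  have hr1 : ∀ y, ‖f y / (f y + h y)‖ ≤ 1 := fun y => by
    have := hf0 y
    have := hh0 y
    rw [Real.norm_of_nonneg (by positivity), div_le_one (by positivity)]
    linarith
  symm
  refine ae_eq_condExp_of_forall_setIntegral_eq hm Measure.integrable_toReal_rnDeriv
    (fun s _ _ => (Integrable.of_bound (hr.comp hT).aestronglyMeasurable 1
      (.of_forall fun x => hr1 _)).integrableOn) ?_
    ((hr.comp (comap_measurable T)).aestronglyMeasurable)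
  rintro s ⟨B, hB, rfl⟩ -
  rw [Measure.setIntegral_toReal_rnDeriv
    (Measure.absolutelyContinuous_of_le (Measure.le_add_right le_rfl)),
    ← setIntegral_map hB hr.aestronglyMeasurable hT.aemeasurable, hmap,
    setIntegral_withDensity_eq_setIntegral_toReal_smul hfh.ennreal_ofReal
      (.of_forall fun _ => ENNReal.ofReal_lt_top) _ hB, measureReal_def,
    ← Measure.map_apply hT hB, hP, withDensity_apply _ hB,
    integral_eq_lintegral_of_nonneg_ae]
  · congr 1
    refine lintegral_congr fun y => ?_
    have := hf0 y
    have := hh0 y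
    rw [ENNReal.toReal_ofReal (by positivity), smul_eq_mul, mul_div_cancel₀ _ (by positivity)]
  · exact .of_forall fun y => by
      have := hf0 y
      have := hh0 y
      simp only [Pi.zero_apply]
      positivity
  · exact (hfh.ennreal_ofReal.ennreal_toReal.smul hr).aestronglyMeasurable

lemma integral_sqrt_ratio_sub_sq_comp {P Q : Measure X} [IsFiniteMeasure P] [IsFiniteMeasure Q]
    {T : X → Y} (hT : Measurable T) {γ : Measure Y} {f h : Y → ℝ}
    (hf : Measurable f) (hh : Measurable h) (hf0 : ∀ y, 0 < f y) (hh0 : ∀ y, 0 < h y)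
    (hP : P.map T = γ.withDensity fun y => ENNReal.ofReal (f y))
    (hQ : Q.map T = γ.withDensity fun y => ENNReal.ofReal (h y)) :
    ∫ x, (√(f (T x) / (f (T x) + h (T x))) - √(h (T x) / (f (T x) + h (T x)))) ^ 2 ∂(P + Q) =
      ∫ y, (√(f y) - √(h y)) ^ 2 ∂γ := by
  have hmap := map_add_eq_withDensity hT hf hf0 hh0 hP hQ
  have hfh : Measurable fun y => f y + h y := hf.add hh
  have hr : Measurable fun y => (√(f y / (f y + h y)) - √(h y / (f y + h y))) ^ 2 := by
    fun_prop
  rw [← integral_map (f := fun y => (√(f y / (f y + h y)) - √(h y / (f y + h y))) ^ 2)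
    hT.aemeasurable hr.aestronglyMeasurable, hmap,
    integral_withDensity_eq_integral_toReal_smul hfh.ennreal_ofReal
      (.of_forall fun _ => ENNReal.ofReal_lt_top)]
  refine integral_congr_ae (.of_forall fun y => ?_)
  have h1 := hf0 y
  have h2 := hh0 y
  have h3 := sq_sqrt (add_pos h1 h2).le
  have h4 := sqrt_pos.2 (add_pos h1 h2)
  beta_reduce
  rw [ENNReal.toReal_ofReal (by positivity), smul_eq_mul, sqrt_div h1.le, sqrt_div h2.le,
    ← sub_div, div_pow, h3, mul_div_cancel₀ _ (by positivity)]

/-- The Hellinger distance is controlled by that of the marginals along a filtration that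
generates the σ-algebra. -/
lemma dH_le_of_marginals {Y : ℕ → Type*} [mY : ∀ n, MeasurableSpace (Y n)]
    {P Q : Measure X} [IsFiniteMeasure P] [IsFiniteMeasure Q] {T : ∀ n, X → Y n}
    (hT : ∀ n, Measurable (T n)) (hmono : Monotone fun n => (mY n).comap (T n))
    (hsup : ⨆ n, (mY n).comap (T n) = mX) {γ : ∀ n, Measure (Y n)} {f h : ∀ n, Y n → ℝ}
    (hf : ∀ n, Measurable (f n)) (hh : ∀ n, Measurable (h n))
    (hf0 : ∀ n y, 0 < f n y) (hh0 : ∀ n y, 0 < h n y)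
    (hP : ∀ n, P.map (T n) = (γ n).withDensity fun y => ENNReal.ofReal (f n y))
    (hQ : ∀ n, Q.map (T n) = (γ n).withDensity fun y => ENNReal.ofReal (h n y))
    {δ : ℝ} (hδ : ∀ n, ∫ y, (√(f n y) - √(h n y)) ^ 2 ∂γ n ≤ δ) :
    dH P Q ≤ √δ := by
  let F : Filtration ℕ mX := ⟨fun n => (mY n).comap (T n), hmono, fun n => (hT n).comap_le⟩
  have hF : ⨆ n, F n = mX := hsup
  have lim : ∀ p : X → ℝ, Measurable p → Integrable p (P + Q) →
      ∀ᵐ x ∂(P + Q), Filter.Tendsto (fun n => ((P + Q)[p | F n]) x) Filter.atTop (nhds (p x)) := by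
    intro p hp hpi
    have h1 := tendsto_ae_condExp (μ := P + Q) (ℱ := F) p
    have h2 : (P + Q)[p | ⨆ n, F n] = p :=
      condExp_of_stronglyMeasurable (hF.le) (by rw [hF]; exact hp.stronglyMeasurable) hpi
    rwa [h2] at h1
  have limP := lim _ (Measure.measurable_rnDeriv P (P + Q)).ennreal_toReal
    Measure.integrable_toReal_rnDeriv
  have limQ := lim _ (Measure.measurable_rnDeriv Q (P + Q)).ennreal_toReal
    Measure.integrable_toReal_rnDeriv
  have eP : ∀ᵐ x ∂(P + Q), ∀ n, ((P + Q)[fun x => (P.rnDeriv (P + Q) x).toReal | F n]) x =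
      f n (T n x) / (f n (T n x) + h n (T n x)) := ae_all_iff.2 fun n =>
    condExp_rnDeriv_comap_ae_eq (hT n) (hf n) (hh n) (hf0 n) (hh0 n) (hP n) (hQ n)
  have eQ : ∀ᵐ x ∂(P + Q), ∀ n, ((P + Q)[fun x => (Q.rnDeriv (P + Q) x).toReal | F n]) x =
      h n (T n x) / (f n (T n x) + h n (T n x)) := ae_all_iff.2 fun n => by
    have := condExp_rnDeriv_comap_ae_eq (hT n) (hh n) (hf n) (hh0 n) (hf0 n) (hQ n) (hP n)
    simp only [add_comm Q P, add_comm (h n _) (f n _)] at this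
    exact this
  refine sqrt_le_sqrt (le_of_tendsto' (tendsto_integral_of_dominated_convergence
    (F := fun n x => (√(f n (T n x) / (f n (T n x) + h n (T n x))) -
      √(h n (T n x) / (f n (T n x) + h n (T n x)))) ^ 2) (fun _ => (1 : ℝ)) (fun n => ?_)
      (integrable_const _) (fun n => .of_forall fun x => ?_) ?_) fun n =>
    (integral_sqrt_ratio_sub_sq_comp (hT n) (hf n) (hh n) (hf0 n) (hh0 n) (hP n)
      (hQ n)).trans_le (hδ n))
  · have hr : Measurable fun y => (√(f n y / (f n y + h n y)) - √(h n y / (f n y + h n y))) ^ 2 :=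
      (((hf n).div ((hf n).add (hh n))).sqrt.sub ((hh n).div ((hf n).add (hh n))).sqrt).pow_const 2
    exact (hr.comp (hT n)).aestronglyMeasurable
  · have h1 := hf0 n (T n x)
    have h2 := hh0 n (T n x)
    rw [Real.norm_of_nonneg (sq_nonneg _), sq_le_one_iff_abs_le_one, abs_sub_le_iff]
    have h3 : √(f n (T n x) / (f n (T n x) + h n (T n x))) ≤ 1 :=
      sqrt_le_one.2 ((div_le_one (by positivity)).2 (by linarith))
    have h4 : √(h n (T n x) / (f n (T n x) + h n (T n x))) ≤ 1 :=
      sqrt_le_one.2 ((div_le_one (by positivity)).2 (by linarith))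
    constructor <;> linarith [sqrt_nonneg (f n (T n x) / (f n (T n x) + h n (T n x))),
      sqrt_nonneg (h n (T n x) / (f n (T n x) + h n (T n x)))]
  · filter_upwards [limP, limQ, eP, eQ] with x h1 h2 h3 h4
    simp only [h3] at h1
    simp only [h4] at h2
    exact ((h1.sqrt).sub h2.sqrt).pow 2

end HellingerLimit

lemma comap_restrict_mono {κ : Type*} {E : κ → Type*} [∀ k, MeasurableSpace (E k)]
    {I J : Finset κ} (h : I ⊆ J) :
    (inferInstance : MeasurableSpace (∀ k : I, E k)).comap (fun (x : ∀ k, E k) (k : I) => x k) ≤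
      (inferInstance : MeasurableSpace (∀ k : J, E k)).comap
        (fun (x : ∀ k, E k) (k : J) => x k) := by
  have : (fun (x : ∀ k, E k) (k : I) => x k) =
    (fun (y : ∀ k : J, E k) (k : I) => y ⟨k, h k.2⟩) ∘ fun (x : ∀ k, E k) (k : J) => x k := rfl
  rw [this, ← MeasurableSpace.comap_comp]
  exact MeasurableSpace.comap_mono (measurable_pi_lambda _ fun _ => measurable_pi_apply _).comap_le

lemma iSup_comap_restrict {κ : Type*} {E : κ → Type*} [∀ k, MeasurableSpace (E k)]
    (I : ℕ → Finset κ) (hI : ∀ k, ∃ n, k ∈ I n) :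
    ⨆ n, (inferInstance : MeasurableSpace (∀ k : I n, E k)).comap
        (fun (x : ∀ k, E k) (k : I n) => x k) =
      (inferInstance : MeasurableSpace (∀ k, E k)) := by
  refine le_antisymm (iSup_le fun n => (Finset.measurable_restrict (I n)).comap_le) ?_
  refine iSup_le fun k => ?_
  obtain ⟨n, hn⟩ := hI k
  refine le_trans ?_ (le_iSup _ n)
  have : (fun x : ∀ k, E k => x k) =
    (fun y : ∀ k : I n, E k => y ⟨k, hn⟩) ∘ fun (x : ∀ k, E k) (k : I n) => x k := rfl
  rw [this, ← MeasurableSpace.comap_comp]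
  exact MeasurableSpace.comap_mono
    (measurable_pi_apply (X := fun k : I n => E k) ⟨k, hn⟩).comap_le

lemma IsMixtureLaw.isProbabilityMeasure {θ : ℤ → ℂ} {g : Measure ℝ} [IsProbabilityMeasure g]
    {P : Measure (ℤ → ℂ)} (h : IsMixtureLaw θ g P) : IsProbabilityMeasure P := by
  obtain ⟨Pp, h1, h2⟩ := h
  refine ⟨?_⟩
  have : ∀ φ, Pp φ univ = 1 := fun φ => (h1 φ).1.measure_univ
  simp [h2 _ .univ, this]

lemma continuous_rotZ (θ : ℤ → ℂ) (k : ℤ) : Continuous fun φ => rotZ θ φ k := by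
  unfold rotZ; fun_prop

lemma IsMixtureLaw.map_restrict {θ : ℤ → ℂ} {g : Measure ℝ} [IsProbabilityMeasure g]
    {P : Measure (ℤ → ℂ)} (h : IsMixtureLaw θ g P) (I : Finset ℤ) (c : I → ℂ) :
    P.map I.restrict = (gaussPi c).withDensity fun z =>
      ENNReal.ofReal (mixDensity c (fun φ (k : I) => rotZ θ φ k) g z) := by
  obtain ⟨Pp, h1, h2⟩ := h
  ext B hB
  rw [← lintegral_gaussPi_apply c (continuous_pi fun k => continuous_rotZ θ k) g hB,
    Measure.map_apply (Finset.measurable_restrict I) hB,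
    h2 _ (Finset.measurable_restrict I hB)]
  refine lintegral_congr fun φ => ?_
  rw [← Measure.map_apply (Finset.measurable_restrict I) hB, (h1 φ).2 I]
  rfl

lemma abs_exp_sub_sum_range_le {x B : ℝ} (h : |x| ≤ B) (M : ℕ) :
    |rexp x - ∑ m ∈ Finset.range M, x ^ m / m.factorial| ≤ B ^ M / M.factorial * rexp B := by
  have hs : ∀ y : ℝ, HasSum (fun n : ℕ => y ^ n / n.factorial) (rexp y) := fun y => by
    rw [Real.exp_eq_exp_ℝ]; exact NormedSpace.expSeries_div_hasSum_exp y
  refine HasSum.norm_le_of_bounded ((hasSum_nat_add_iff' M).2 (hs x))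
    ((hs B).mul_left (B ^ M / M.factorial)) fun j => ?_
  have hB : 0 ≤ B := (abs_nonneg x).trans h
  rw [norm_div, norm_pow, Real.norm_eq_abs, Real.norm_natCast, div_mul_div_comm, ← pow_add,
    add_comm M j]
  have : (M.factorial * j.factorial : ℝ) ≤ (j + M).factorial := by
    rw [add_comm j M]
    exact_mod_cast Nat.le_of_dvd (Nat.factorial_pos _)
      (Nat.factorial_mul_factorial_dvd_factorial_add M j)
  gcongr

/-- The Fourier mode `x ↦ e^{2iπkx}`. -/
noncomputable def fourierMode (k : ℤ) (x : ℝ) : ℂ := Complex.exp (2 * π * Complex.I * k * x)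

lemma fourierMode_mul (j k : ℤ) : fourierMode j * fourierMode k = fourierMode (j + k) := by
  ext x
  simp only [Pi.mul_apply, fourierMode, ← Complex.exp_add]
  push_cast
  ring_nf

lemma conj_fourierMode (k : ℤ) (x : ℝ) :
    (starRingEnd ℂ) (fourierMode k x) = fourierMode (-k) x := by
  simp [fourierMode, ← Complex.exp_conj, map_ofNat]

lemma norm_fourierMode (k : ℤ) (x : ℝ) : ‖fourierMode k x‖ = 1 := by
  have : fourierMode k x = Complex.exp ((2 * π * k * x : ℝ) * Complex.I) := by
    unfold fourierMode; push_cast; ring_nf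
  rw [this, Complex.norm_exp_ofReal_mul_I]

lemma norm_fourierMode_sub_le (k : ℤ) (x y : ℝ) :
    ‖fourierMode k x - fourierMode k y‖ ≤ 2 * π * |(k : ℝ)| * |x - y| := by
  have h : fourierMode k x - fourierMode k y =
      fourierMode k y * (Complex.exp (Complex.I * (2 * π * k * (x - y) : ℝ)) - 1) := by
    rw [mul_sub, mul_one, fourierMode, fourierMode, ← Complex.exp_add]
    push_cast
    ring_nf
  rw [h, norm_mul, norm_fourierMode, one_mul]
  refine (Real.norm_exp_I_mul_ofReal_sub_one_le).trans_eq ?_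
  rw [Real.norm_eq_abs, abs_mul, abs_mul, abs_of_pos two_pi_pos]

/-- The trigonometric polynomials of degree at most `d`. -/
def trigPoly (d : ℕ) : Submodule ℂ (ℝ → ℂ) :=
  Submodule.span ℂ (fourierMode '' {k : ℤ | |k| ≤ d})

lemma fourierMode_mem_trigPoly {k : ℤ} {d : ℕ} (h : |k| ≤ d) : fourierMode k ∈ trigPoly d :=
  Submodule.subset_span ⟨k, h, rfl⟩

lemma trigPoly_mono {a b : ℕ} (h : a ≤ b) : trigPoly a ≤ trigPoly b :=
  Submodule.span_mono (image_mono fun k (hk : |k| ≤ a) => hk.trans (by exact_mod_cast h))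

lemma mul_mem_trigPoly {a b : ℕ} {f g : ℝ → ℂ} (hf : f ∈ trigPoly a) (hg : g ∈ trigPoly b) :
    f * g ∈ trigPoly (a + b) := by
  have h : trigPoly a * trigPoly b ≤ trigPoly (a + b) := by
    rw [trigPoly, trigPoly, Submodule.span_mul_span, Submodule.span_le]
    rintro _ ⟨_, ⟨j, hj, rfl⟩, _, ⟨k, hk, rfl⟩, rfl⟩
    simp only [fourierMode_mul]
    refine fourierMode_mem_trigPoly ((abs_add_le j k).trans ?_)
    push_cast
    exact add_le_add hj hk
  exact h (Submodule.mul_mem_mul hf hg)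

lemma pow_mem_trigPoly {a : ℕ} {f : ℝ → ℂ} (hf : f ∈ trigPoly a) (n : ℕ) :
    f ^ n ∈ trigPoly (n * a) := by
  induction n with
  | zero =>
    have : (f ^ 0) = fourierMode 0 := by ext x; simp [fourierMode]
    rw [this]
    exact fourierMode_mem_trigPoly (by simp)
  | succ n ih =>
    rw [pow_succ, Nat.succ_mul]
    exact mul_mem_trigPoly ih hf

lemma sum_mul_trigPoly_eq_zero {κ : Type*} [Fintype κ] {w x : κ → ℝ} {d : ℕ}
    (h : ∀ k : ℤ, |k| ≤ d → ∑ i, (w i : ℂ) * fourierMode k (x i) = 0) {f : ℝ → ℂ}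
    (hf : f ∈ trigPoly d) : ∑ i, (w i : ℂ) * f (x i) = 0 := by
  induction hf using Submodule.span_induction with
  | mem f hf => obtain ⟨k, hk, rfl⟩ := hf; exact h k hk
  | zero => simp
  | add f g _ _ hf hg => simp only [Pi.add_apply, mul_add, Finset.sum_add_distrib, hf, hg, add_zero]
  | smul a f _ hf =>
    simp only [Pi.smul_apply, smul_eq_mul, mul_left_comm _ a, ← Finset.mul_sum, hf, mul_zero]

/-- If all the moments of the weights `w` up to degree `ℓ (M - 1)` vanish, then the quadratic form
of `exp ∘ K`, with `K` a trigonometric polynomial of degree `ℓ` in its first variable, is small. -/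
lemma sum_sum_mul_exp_le {κ : Type*} [Fintype κ] {w x : κ → ℝ} {d ℓ M : ℕ} {W B : ℝ}
    (hd : M * ℓ ≤ d)
    (h : ∀ k : ℤ, |k| ≤ d → ∑ i, (w i : ℂ) * fourierMode k (x i) = 0) (hw : ∑ i, |w i| ≤ W)
    {K : ℝ → ℝ → ℝ} (hK : ∀ y, (fun x => (K x y : ℂ)) ∈ trigPoly ℓ) (hB : ∀ x y, |K x y| ≤ B) :
    ∑ i, ∑ j, w i * w j * rexp (K (x i) (x j)) ≤ W ^ 2 * (B ^ M / M.factorial * rexp B) := by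
  have hzero : ∀ m < M, ∀ j, ∑ i, w i * K (x i) (x j) ^ m = 0 := by
    intro m hm j
    have := sum_mul_trigPoly_eq_zero h (trigPoly_mono ((Nat.mul_le_mul_right ℓ hm.le).trans hd)
      (pow_mem_trigPoly (hK (x j)) m))
    simp only [Pi.pow_apply] at this
    exact_mod_cast this
  have hzero' : ∑ i, ∑ j, w i * w j * ∑ m ∈ Finset.range M, K (x i) (x j) ^ m / m.factorial =
      0 := by
    rw [Finset.sum_comm]
    refine Finset.sum_eq_zero fun j _ => ?_
    simp_rw [Finset.mul_sum]
    rw [Finset.sum_comm]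
    refine Finset.sum_eq_zero fun m hm => ?_
    calc _ = w j / m.factorial * ∑ i, w i * K (x i) (x j) ^ m := by
          rw [Finset.mul_sum]
          exact Finset.sum_congr rfl fun i _ => by ring
      _ = 0 := by rw [hzero m (Finset.mem_range.1 hm) j, mul_zero]
  set τ := B ^ M / M.factorial * rexp B
  have hτ : ∀ i j, w i * w j * (rexp (K (x i) (x j)) -
      ∑ m ∈ Finset.range M, K (x i) (x j) ^ m / m.factorial) ≤ |w i| * |w j| * τ := fun i j => by
    refine (le_abs_self _).trans ?_
    rw [abs_mul, abs_mul]
    exact mul_le_mul_of_nonneg_left (abs_exp_sub_sum_range_le (hB _ _) M) (by positivity)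
  calc ∑ i, ∑ j, w i * w j * rexp (K (x i) (x j))
      = ∑ i, ∑ j, w i * w j * (rexp (K (x i) (x j)) -
        ∑ m ∈ Finset.range M, K (x i) (x j) ^ m / m.factorial) := by
        simp_rw [mul_sub, Finset.sum_sub_distrib]
        rw [hzero', sub_zero]
    _ ≤ ∑ i, ∑ j, |w i| * |w j| * τ :=
        Finset.sum_le_sum fun i _ => Finset.sum_le_sum fun j _ => hτ i j
    _ = (∑ i, |w i|) ^ 2 * τ := by
        rw [sq, Finset.sum_mul_sum, Finset.sum_mul]
        simp_rw [Finset.sum_mul]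
    _ ≤ W ^ 2 * τ := by
        have hB0 : 0 ≤ B := (abs_nonneg _).trans (hB 0 0)
        have : 0 ≤ τ := by positivity
        gcongr

/-- Carathéodory's theorem for images of finitely supported probability vectors. -/
lemma exists_caratheodory {E : Type*} [AddCommGroup E] [Module ℝ E] [FiniteDimensional ℝ E]
    (Φ : ℝ → E) (S : Finset ℝ) {w : ℝ → ℝ} (hw : ∀ x ∈ S, 0 ≤ w x) (hw1 : ∑ x ∈ S, w x = 1) :
    ∃ (J : ℕ) (ψ p : Fin J → ℝ), J ≤ Module.finrank ℝ E + 1 ∧ Function.Injective ψ ∧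
      (∀ j, ψ j ∈ S) ∧ (∀ j, 0 ≤ p j) ∧ ∑ j, p j = 1 ∧
      ∑ j, p j • Φ (ψ j) = ∑ x ∈ S, w x • Φ x := by
  have hmem : ∑ x ∈ S, w x • Φ x ∈ convexHull ℝ (Φ '' S) :=
    (convex_convexHull ℝ _).sum_mem hw hw1 fun x hx => subset_convexHull ℝ _ ⟨x, hx, rfl⟩
  obtain ⟨κ, _, z, p, hz, hind, hp, hp1, hpz⟩ := eq_pos_convex_span_of_mem_convexHull hmem
  have hz' : ∀ i, ∃ x ∈ S, Φ x = z i := fun i => hz ⟨i, rfl⟩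
  choose ψ hψS hψ using hz'
  let e := (Fintype.equivFin κ).symm
  refine ⟨Fintype.card κ, ψ ∘ e, p ∘ e, ?_, ?_, fun j => hψS _, fun j => (hp _).le, ?_, ?_⟩
  · exact hind.card_le_finrank_succ.trans (Nat.add_le_add_right (Submodule.finrank_le _) 1)
  · refine Function.Injective.comp (fun i j hij => hind.injective ?_) e.injective
    rw [← hψ i, ← hψ j, hij]
  · exact (e.sum_comp p).trans hp1
  · rw [← hpz, ← e.sum_comp]
    exact Finset.sum_congr rfl fun j _ => by simp only [Function.comp_apply, hψ]

/-- A grid of mesh `h` in `[0,1]` together with the map rounding down to it. -/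
lemma exists_grid {h : ℝ} (hh : 0 < h) :
    ∃ (S : Finset ℝ) (T : ℝ → ℝ), Measurable T ∧ (∀ x, T x ∈ S) ∧ (∀ x ∈ S, x ∈ Icc (0 : ℝ) 1) ∧
      (∀ x ∈ Icc (0 : ℝ) 1, |x - T x| ≤ h) ∧ ∀ x ∈ S, ∀ y ∈ S, x ≠ y → h ≤ |x - y| := by
  classical
  let T : ℝ → ℝ := fun x => if x ∈ Icc (0 : ℝ) 1 then h * ⌊x / h⌋₊ else 0
  refine ⟨(Finset.range (⌊1 / h⌋₊ + 1)).image fun n : ℕ => h * n, T, ?_, ?_, ?_, ?_, ?_⟩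
  · refine Measurable.ite measurableSet_Icc ?_ measurable_const
    exact ((measurable_from_nat (f := fun n : ℕ => (n : ℝ))).comp
      (Nat.measurable_floor.comp (measurable_id.div_const h))).const_mul h
  · intro x
    simp only [T]
    split_ifs with hx
    · refine Finset.mem_image_of_mem _ (Finset.mem_range.2 (Nat.lt_succ_of_le ?_))
      exact Nat.floor_le_floor (div_le_div_of_nonneg_right hx.2 hh.le)
    · exact Finset.mem_image.2 ⟨0, by simp, by simp⟩
  · intro x hx
    obtain ⟨n, hn, rfl⟩ := Finset.mem_image.1 hx
    refine ⟨by positivity, ?_⟩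
    have : (n : ℝ) ≤ 1 / h := (Nat.le_floor_iff (by positivity)).1
      (Nat.lt_succ_iff.1 (Finset.mem_range.1 hn))
    calc h * n ≤ h * (1 / h) := by gcongr
      _ = 1 := by field_simp
  · intro x hx
    have h0 : 0 ≤ x / h := div_nonneg hx.1 hh.le
    have h1 := mul_le_mul_of_nonneg_left (Nat.floor_le h0) hh.le
    have h2 := mul_le_mul_of_nonneg_left (Nat.lt_floor_add_one (x / h)).le hh.le
    rw [mul_div_cancel₀ _ hh.ne'] at h1 h2
    simp only [T, if_pos hx]
    rw [abs_le]
    constructor <;> linarith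
  · intro x hx y hy hxy
    obtain ⟨m, -, rfl⟩ := Finset.mem_image.1 hx
    obtain ⟨n, -, rfl⟩ := Finset.mem_image.1 hy
    have hmn : (m : ℤ) - n ≠ 0 := fun h0 => hxy (by rw [show m = n by omega])
    have h1 : (1 : ℝ) ≤ |(m : ℝ) - n| := by exact_mod_cast Int.one_le_abs hmn
    rw [← mul_sub, abs_mul, abs_of_pos hh]
    exact le_mul_of_one_le_right hh.le h1

lemma integral_comp_eq_sum {g : Measure ℝ} [IsProbabilityMeasure g] {S : Finset ℝ} {T : ℝ → ℝ}
    (hT : Measurable T) (hTS : ∀ x, T x ∈ S) (F : ℝ → ℝ) :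
    ∫ x, F (T x) ∂g = ∑ y ∈ S, g.real (T ⁻¹' {y}) * F y := by
  classical
  have h1 : ∀ x, F (T x) = ∑ y ∈ S, (T ⁻¹' {y}).indicator (fun _ => F y) x := fun x => by
    have h0 : ∑ y ∈ S, (T ⁻¹' {y}).indicator (fun _ => F y) x
        = (T ⁻¹' {T x}).indicator (fun _ => F (T x)) x :=
      Finset.sum_eq_single_of_mem (T x) (hTS x) fun y _ hy =>
        indicator_of_notMem (fun h : T x = y => hy h.symm) _
    rw [h0]
    exact (indicator_of_mem (show x ∈ T ⁻¹' {T x} from rfl) (fun _ => F (T x))).symm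
  simp_rw [h1]
  rw [integral_finsetSum _ fun y _ => (integrable_const _).indicator
    (hT (measurableSet_singleton y))]
  refine Finset.sum_congr rfl fun y _ => ?_
  rw [integral_indicator_const _ (hT (measurableSet_singleton y)), smul_eq_mul]

/-- Separated nodes and weights that integrate approximately every Lipschitz function which is
nearly orthogonal to signed measures with vanishing moments. -/
lemma exists_separated_quadrature {g : Measure ℝ} (hg : IsProbOn01 g) {h : ℝ} (hh : 0 < h)
    (d : ℕ) :
    ∃ (J : ℕ) (ψ p : Fin J → ℝ), J ≤ 4 * d + 3 ∧ (∀ j, ψ j ∈ Icc (0 : ℝ) 1) ∧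
      (∀ i j, i ≠ j → h ≤ |ψ i - ψ j|) ∧ (∀ j, 0 ≤ p j) ∧ ∑ j, p j = 1 ∧
      ∀ (F : ℝ → ℝ) (L τ : ℝ), 0 ≤ L → (∀ x y, |F x - F y| ≤ L * |x - y|) → (∀ x, |F x| ≤ 1) →
        (∀ (κ : Type) [Fintype κ] (w x : κ → ℝ), ∑ i, |w i| ≤ 2 →
          (∀ k : ℤ, |k| ≤ d → ∑ i, (w i : ℂ) * fourierMode k (x i) = 0) →
          ∑ i, w i * F (x i) ≤ τ) →
        ∫ x, F x ∂g - ∑ j, p j * F (ψ j) ≤ L * h + τ := by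
  have := hg.1
  obtain ⟨S, T, hT, hTS, hS, hTx, hsep⟩ := exists_grid hh
  have hw1 : ∑ y ∈ S, g.real (T ⁻¹' {y}) = 1 := by
    have := integral_comp_eq_sum (g := g) hT hTS fun _ => 1
    simpa using this.symm
  let Φ : ℝ → (Finset.Icc (-(d : ℤ)) d → ℂ) := fun x k => fourierMode k x
  obtain ⟨J, ψ, p, hJ, hinj, hψ, hp, hp1, hΦ⟩ := exists_caratheodory Φ S
    (fun y _ => measureReal_nonneg (μ := g) (s := T ⁻¹' {y})) hw1
  refine ⟨J, ψ, p, ?_, fun j => hS _ (hψ j), fun i j hij => hsep _ (hψ i) _ (hψ j)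
    (hinj.ne hij), hp, hp1, ?_⟩
  · refine hJ.trans (le_of_eq ?_)
    rw [Module.finrank_pi_fintype]
    simp only [Complex.finrank_real_complex, Finset.sum_const, Finset.card_univ,
      Fintype.card_coe, Int.card_Icc, smul_eq_mul]
    omega
  intro F L τ hL hF hF1 hτ
  have hFc : Continuous F := by
    refine (LipschitzWith.of_dist_le_mul (K := ⟨L, hL⟩) fun x y => ?_).continuous
    exact hF x y
  have hFi : ∀ T : ℝ → ℝ, Measurable T → Integrable (fun x => F (T x)) g := fun T hT =>
    Integrable.of_bound (hFc.measurable.comp hT).aestronglyMeasurable 1 (.of_forall fun x => hF1 _)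
  have hFi0 : Integrable F g := hFi id measurable_id
  have h1 : ∫ x, F x ∂g - ∫ x, F (T x) ∂g ≤ L * h := by
    rw [← integral_sub hFi0 (hFi T hT)]
    have hae : ∀ᵐ x ∂g, x ∈ Icc (0 : ℝ) 1 := (prob_compl_eq_zero_iff measurableSet_Icc).2 hg.2
    calc ∫ x, (F x - F (T x)) ∂g ≤ ∫ _, L * h ∂g := by
          refine integral_mono_ae (hFi0.sub (hFi T hT)) (integrable_const _) ?_
          filter_upwards [hae] with x hx
          exact (le_abs_self _).trans ((hF _ _).trans (mul_le_mul_of_nonneg_left (hTx x hx) hL))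
      _ = L * h := by simp
  have h2 := hτ (S ⊕ Fin J)
    (Sum.elim (fun y : S => g.real (T ⁻¹' {(y : ℝ)})) fun j => -p j) (Sum.elim (fun y => y) ψ) ?_ ?_
  · rw [Fintype.sum_sum_type] at h2
    simp only [Sum.elim_inl, Sum.elim_inr, neg_mul, Finset.sum_neg_distrib] at h2
    rw [Finset.sum_coe_sort S fun y => g.real (T ⁻¹' {y}) * F y,
      ← integral_comp_eq_sum hT hTS F] at h2
    linarith
  · rw [Fintype.sum_sum_type]
    simp only [Sum.elim_inl, Sum.elim_inr, abs_neg, abs_of_nonneg (hp _), hp1,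
      abs_of_nonneg measureReal_nonneg]
    rw [Finset.sum_coe_sort S fun y => g.real (T ⁻¹' {y}), hw1]
    norm_num
  · intro k hk
    rw [Fintype.sum_sum_type]
    simp only [Sum.elim_inl, Sum.elim_inr, Complex.ofReal_neg, neg_mul, Finset.sum_neg_distrib]
    rw [Finset.sum_coe_sort S fun y => (g.real (T ⁻¹' {y}) : ℂ) * fourierMode k y]
    have h3 := congrFun hΦ ⟨k, Finset.mem_Icc.2 (abs_le.1 hk)⟩
    simp only [Finset.sum_apply, Pi.smul_apply, Complex.real_smul, Φ] at h3
    rw [h3, add_neg_cancel]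

/-- A discrete measure with separated nodes is close, on Lipschitz functions, to any probability
measure giving almost the same mass to small intervals around the nodes. -/
lemma sum_sub_integral_le {g : Measure ℝ} [IsProbabilityMeasure g] {J : ℕ} {ψ p : Fin J → ℝ}
    {η δ L : ℝ} (hη : 0 < η) (hψ : ∀ i j, i ≠ j → 2 * η ≤ |ψ i - ψ j|)
    (hg : ∑ j, |(g (Icc (ψ j - η / 2) (ψ j + η / 2))).toReal - p j| ≤ δ) (hp1 : ∑ j, p j = 1)
    {F : ℝ → ℝ} (hL : 0 ≤ L) (hF : ∀ x y, |F x - F y| ≤ L * |x - y|) (hF1 : ∀ x, |F x| ≤ 1) :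
    ∑ j, p j * F (ψ j) - ∫ x, F x ∂g ≤ L * η + 2 * δ := by
  have hFc : Continuous F := by
    refine (LipschitzWith.of_dist_le_mul (K := ⟨L, hL⟩) fun x y => ?_).continuous
    exact hF x y
  have hFi : Integrable F g :=
    Integrable.of_bound hFc.aestronglyMeasurable 1 (.of_forall fun x => hF1 _)
  set A : Fin J → Set ℝ := fun j => Icc (ψ j - η / 2) (ψ j + η / 2) with hA
  have hAm : ∀ j, MeasurableSet (A j) := fun j => measurableSet_Icc
  have hdisj : Pairwise (Function.onFun Disjoint A) := by
    intro i j hij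
    refine Set.disjoint_left.2 fun x hi hj => ?_
    have h1 := hψ i j hij
    have h2 : |ψ i - ψ j| ≤ η := by
      rw [abs_le]
      constructor <;> linarith [hi.1, hi.2, hj.1, hj.2]
    linarith
  have hUm : MeasurableSet (⋃ j, A j) := MeasurableSet.iUnion hAm
  have hU : g.real (⋃ j, A j) = ∑ j, g.real (A j) := by
    rw [measureReal_iUnion_fintype hdisj hAm]
  have hrest : g.real (⋃ j, A j)ᶜ ≤ δ := by
    rw [probReal_compl_eq_one_sub hUm, hU, ← hp1, ← Finset.sum_sub_distrib]
    refine (Finset.sum_le_sum fun j _ => ?_).trans hg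
    rw [abs_sub_comm]
    exact le_abs_self _
  have hc : -δ ≤ ∫ x in (⋃ j, A j)ᶜ, F x ∂g := by
    calc -δ ≤ -g.real (⋃ j, A j)ᶜ := by linarith
      _ = ∫ _ in (⋃ j, A j)ᶜ, (-1 : ℝ) ∂g := by simp
      _ ≤ _ := integral_mono (integrable_const _) hFi.integrableOn fun x => (abs_le.1 (hF1 x)).1
  have hAj : ∀ j, g.real (A j) * F (ψ j) - g.real (A j) * (L * η) ≤ ∫ x in A j, F x ∂g := by
    intro j
    calc _ = ∫ _ in A j, (F (ψ j) - L * η) ∂g := by simp [mul_sub]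
      _ ≤ _ := by
        refine setIntegral_mono_on (integrable_const _) hFi.integrableOn (hAm j) fun x hx => ?_
        have h1 := (le_abs_self _).trans (hF (ψ j) x)
        have h2 : |ψ j - x| ≤ η := by
          rw [abs_le]
          constructor <;> linarith [hx.1, hx.2]
        have h3 := mul_le_mul_of_nonneg_left h2 hL
        linarith
  have hpF : ∑ j, p j * F (ψ j) - ∑ j, g.real (A j) * F (ψ j) ≤ δ := by
    rw [← Finset.sum_sub_distrib]
    refine (Finset.sum_le_sum fun j _ => ?_).trans hg
    rw [← sub_mul, abs_sub_comm]
    refine (le_abs_self _).trans ?_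
    rw [abs_mul]
    exact mul_le_of_le_one_right (abs_nonneg _) (hF1 _)
  have hmass : ∑ j, g.real (A j) * (L * η) ≤ L * η := by
    rw [← Finset.sum_mul, ← hU]
    exact mul_le_of_le_one_left (by positivity) measureReal_le_one
  have hsum := Finset.sum_le_sum fun j (_ : j ∈ Finset.univ) => hAj j
  rw [Finset.sum_sub_distrib, ← integral_iUnion_fintype hAm hdisj fun j => hFi.integrableOn] at hsum
  rw [← integral_add_compl hUm hFi]
  linarith

section GaussianMoments

variable {ι : Type*} [Fintype ι]

lemma abs_integral_mul_gaussRatio_le (c m : ι → ℂ) {u : (ι → ℂ) → ℝ} (hu1 : ∀ z, |u z| ≤ 1) :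
    |∫ z, u z * gaussRatio c m z ∂gaussPi c| ≤ 1 := by
  rw [← integral_gaussRatio c m]
  refine abs_integral_le_integral_abs.trans (integral_mono_of_nonneg (.of_forall fun z =>
    abs_nonneg _) (integrable_gaussRatio c m) (.of_forall fun z => ?_))
  simp only [abs_mul, abs_of_pos (gaussRatio_pos c m z)]
  exact mul_le_of_le_one_left (gaussRatio_pos c m z).le (hu1 z)

lemma integrable_mul_gaussRatio (c m : ι → ℂ) {u : (ι → ℂ) → ℝ} (hu : Measurable u)
    (hu1 : ∀ z, |u z| ≤ 1) : Integrable (fun z => u z * gaussRatio c m z) (gaussPi c) :=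
  (integrable_gaussRatio c m).bdd_mul hu.aestronglyMeasurable (c := 1) (.of_forall hu1)

lemma abs_integral_mul_gaussRatio_sub_le (c m m' : ι → ℂ) {u : (ι → ℂ) → ℝ} (hu : Measurable u)
    (hu1 : ∀ z, |u z| ≤ 1) {r : ℝ} (hr : 0 ≤ r) (h : ∑ i, ‖m i - m' i‖ ^ 2 ≤ r ^ 2) :
    |∫ z, u z * gaussRatio c m z ∂gaussPi c - ∫ z, u z * gaussRatio c m' z ∂gaussPi c| ≤
      3 * r := by
  rw [← integral_sub (integrable_mul_gaussRatio c m hu hu1)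
    (integrable_mul_gaussRatio c m' hu hu1)]
  refine abs_integral_le_integral_abs.trans
    (le_trans ?_ (integral_abs_gaussRatio_sub_le c m m' hr h))
  refine integral_mono_of_nonneg (.of_forall fun z => abs_nonneg _)
    ((integrable_gaussRatio c m).sub (integrable_gaussRatio c m')).abs (.of_forall fun z => ?_)
  simp only [← mul_sub, abs_mul]
  exact mul_le_of_le_one_left (abs_nonneg _) (hu1 z)

/-- The `L²` norm of a linear combination of Gaussian likelihood ratios. -/
lemma integral_sum_gaussRatio_sq {κ : Type*} [Fintype κ] (c : ι → ℂ) (a : κ → ι → ℂ) (w : κ → ℝ) :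
    Integrable (fun z => (∑ i, w i * gaussRatio c (a i) z) ^ 2) (gaussPi c) ∧
    ∫ z, (∑ i, w i * gaussRatio c (a i) z) ^ 2 ∂gaussPi c = ∑ i, ∑ j, w i * w j *
      rexp (2 * ∑ k, ((a i k - c k) * (starRingEnd ℂ) (a j k - c k)).re) := by
  have h1 : (fun z => (∑ i, w i * gaussRatio c (a i) z) ^ 2) = fun z => ∑ i, ∑ j,
      gaussRatio c (fun k => a i k + a j k - c k) z * (w i * w j *
        rexp (2 * ∑ k, ((a i k - c k) * (starRingEnd ℂ) (a j k - c k)).re)) := by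
    ext z
    rw [sq, Finset.sum_mul_sum]
    refine Finset.sum_congr rfl fun i _ => Finset.sum_congr rfl fun j _ => ?_
    rw [mul_mul_mul_comm, gaussRatio_mul]
    ring
  have h2 : ∀ i j, Integrable (fun z => gaussRatio c (fun k => a i k + a j k - c k) z * (w i * w j *
        rexp (2 * ∑ k, ((a i k - c k) * (starRingEnd ℂ) (a j k - c k)).re))) (gaussPi c) :=
    fun i j => (integrable_gaussRatio c _).mul_const _
  rw [h1]
  refine ⟨integrable_finsetSum _ fun i _ => integrable_finsetSum _ fun j _ => h2 i j, ?_⟩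
  rw [integral_finsetSum _ fun i _ => integrable_finsetSum _ fun j _ => h2 i j]
  refine Finset.sum_congr rfl fun i _ => ?_
  rw [integral_finsetSum _ fun j _ => h2 i j]
  refine Finset.sum_congr rfl fun j _ => ?_
  rw [integral_mul_const, integral_gaussRatio, one_mul]

lemma sum_mul_integral_gaussRatio_le {κ : Type*} [Fintype κ] (c : ι → ℂ) (a : κ → ι → ℂ)
    (w : κ → ℝ) {u : (ι → ℂ) → ℝ} (hu : Measurable u) (hu1 : ∀ z, |u z| ≤ 1) {T δ : ℝ}
    (hδ : 0 < δ) (h : ∑ i, ∑ j, w i * w j *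
      rexp (2 * ∑ k, ((a i k - c k) * (starRingEnd ℂ) (a j k - c k)).re) ≤ T) :
    ∑ i, w i * ∫ z, u z * gaussRatio c (a i) z ∂gaussPi c ≤ T / (2 * δ) + δ / 2 := by
  obtain ⟨hi, he⟩ := integral_sum_gaussRatio_sq c a w
  have hui : ∀ i, Integrable (fun z => w i * (u z * gaussRatio c (a i) z)) (gaussPi c) :=
    fun i => (integrable_mul_gaussRatio c (a i) hu hu1).const_mul _
  calc ∑ i, w i * ∫ z, u z * gaussRatio c (a i) z ∂gaussPi c
      = ∫ z, ∑ i, w i * (u z * gaussRatio c (a i) z) ∂gaussPi c := by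
        rw [integral_finsetSum _ fun i _ => hui i]
        simp_rw [integral_const_mul]
    _ ≤ ∫ z, ((∑ i, w i * gaussRatio c (a i) z) ^ 2 / (2 * δ) + δ / 2) ∂gaussPi c := by
        refine integral_mono (integrable_finsetSum _ fun i _ => hui i)
          ((hi.div_const _).add (integrable_const _)) fun z => ?_
        have h1 : ∑ i, w i * (u z * gaussRatio c (a i) z) =
            u z * ∑ i, w i * gaussRatio c (a i) z := by
          rw [Finset.mul_sum]
          exact Finset.sum_congr rfl fun i _ => by ring
        simp only [h1]
        generalize ∑ i, w i * gaussRatio c (a i) z = S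
        have h2 : u z ^ 2 ≤ 1 := (sq_le_one_iff_abs_le_one _).2 (hu1 z)
        rw [div_add_div _ _ (by positivity) two_ne_zero, le_div_iff₀ (by positivity)]
        nlinarith [sq_nonneg (S - δ * u z), mul_le_mul_of_nonneg_left h2 (sq_nonneg δ)]
    _ = (∑ i, ∑ j, w i * w j *
          rexp (2 * ∑ k, ((a i k - c k) * (starRingEnd ℂ) (a j k - c k)).re)) / (2 * δ) +
            δ / 2 := by
        rw [integral_add (hi.div_const _) (integrable_const _), integral_div, he]
        simp
    _ ≤ T / (2 * δ) + δ / 2 := by gcongr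

end GaussianMoments

section Sobolev

lemma rotZ_eq (θ : ℤ → ℂ) (φ : ℝ) (k : ℤ) : rotZ θ φ k = θ k * fourierMode (-k) φ := by
  unfold rotZ fourierMode
  congr 2
  push_cast
  ring

lemma norm_rotZ_sub (θ θ' : ℤ → ℂ) (φ : ℝ) (k : ℤ) :
    ‖rotZ θ φ k - rotZ θ' φ k‖ = ‖θ k - θ' k‖ := by
  rw [rotZ_eq, rotZ_eq, ← sub_mul, norm_mul, norm_fourierMode, mul_one]

lemma norm_trunc_le (θ : ℤ → ℂ) (ℓ : ℕ) (k : ℤ) : ‖trunc θ ℓ k‖ ≤ ‖θ k‖ := by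
  unfold trunc
  split_ifs <;> simp

lemma rotZ_trunc_sub (θ : ℤ → ℂ) (ℓ : ℕ) (x : ℝ) (k : ℤ) :
    rotZ (trunc θ ℓ) x k - trunc θ 0 k = (trunc θ ℓ k - trunc θ 0 k) * fourierMode (-k) x := by
  rw [rotZ_eq]
  rcases eq_or_ne k 0 with rfl | hk
  · simp [fourierMode, trunc]
  · simp [trunc, hk]

lemma sq_abs_le_rpow {s : ℝ} (hs : 1 ≤ s) (k : ℤ) : |(k : ℝ)| ^ 2 ≤ |(k : ℝ)| ^ (2 * s) := by
  rcases eq_or_ne k 0 with rfl | hk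
  · simpa using zero_rpow_nonneg (2 * s)
  · have h1 : (1 : ℝ) ≤ |(k : ℝ)| := by exact_mod_cast Int.one_le_abs hk
    rw [← rpow_natCast]
    exact rpow_le_rpow_of_exponent_le h1 (by push_cast; linarith)

variable {θ : ℤ → ℂ} {s Q : ℝ}

/-- Finite partial sums of the squared Sobolev seminorm. -/
lemma sum_sobolev_le (hθ : Summable fun k : ℤ => |(k : ℝ)| ^ (2 * s) * ‖θ k‖ ^ 2)
    (hQ : √(∑' k : ℤ, |(k : ℝ)| ^ (2 * s) * ‖θ k‖ ^ 2) = Q) (I : Finset ℤ) :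
    ∑ k : I, |((k : ℤ) : ℝ)| ^ (2 * s) * ‖θ k‖ ^ 2 ≤ Q ^ 2 := by
  rw [← hQ, sq_sqrt (tsum_nonneg fun k => by positivity),
    Finset.sum_coe_sort I fun k : ℤ => |(k : ℝ)| ^ (2 * s) * ‖θ k‖ ^ 2]
  exact hθ.sum_le_tsum _ fun k _ => by positivity

/-- The rotation orbit of a Sobolev sequence is Lipschitz in the angle. -/
lemma sum_norm_rotZ_trunc_sub_sq_le (hs : 1 ≤ s) {I : Finset ℤ}
    (hI : ∑ k : I, |((k : ℤ) : ℝ)| ^ (2 * s) * ‖θ k‖ ^ 2 ≤ Q ^ 2) (ℓ : ℕ) (x y : ℝ) :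
    ∑ k : I, ‖rotZ (trunc θ ℓ) x k - rotZ (trunc θ ℓ) y k‖ ^ 2 ≤ (2 * π * Q * |x - y|) ^ 2 := by
  calc _ ≤ ∑ k : I, (2 * π * |x - y|) ^ 2 * (|((k : ℤ) : ℝ)| ^ (2 * s) * ‖θ k‖ ^ 2) := by
        refine Finset.sum_le_sum fun k _ => ?_
        have h1 : ‖rotZ (trunc θ ℓ) x k - rotZ (trunc θ ℓ) y k‖ ≤
            ‖θ k‖ * (2 * π * |((k : ℤ) : ℝ)| * |x - y|) := by
          rw [rotZ_eq, rotZ_eq, ← mul_sub, norm_mul]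
          have := norm_fourierMode_sub_le (-(k : ℤ)) x y
          rw [Int.cast_neg, abs_neg] at this
          gcongr
          exact norm_trunc_le _ _ _
        calc _ ≤ (‖θ k‖ * (2 * π * |((k : ℤ) : ℝ)| * |x - y|)) ^ 2 := by gcongr
          _ = (2 * π * |x - y|) ^ 2 * (|((k : ℤ) : ℝ)| ^ 2 * ‖θ k‖ ^ 2) := by ring
          _ ≤ _ := by
            gcongr
            exact sq_abs_le_rpow hs k
    _ ≤ (2 * π * |x - y|) ^ 2 * Q ^ 2 := by
        rw [← Finset.mul_sum]
        gcongr
    _ = _ := by ring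

lemma sum_norm_trunc_sub_sq_le (hs : 1 ≤ s) {I : Finset ℤ}
    (hI : ∑ k : I, |((k : ℤ) : ℝ)| ^ (2 * s) * ‖θ k‖ ^ 2 ≤ Q ^ 2) (ℓ : ℕ) :
    ∑ k : I, ‖trunc θ ℓ k - trunc θ 0 k‖ ^ 2 ≤ Q ^ 2 := by
  refine (Finset.sum_le_sum fun k _ => ?_).trans hI
  rcases eq_or_ne (k : ℤ) 0 with hk | hk
  · simp only [hk, trunc, abs_zero, Nat.cast_nonneg, if_true, sub_self, norm_zero]
    rw [zero_pow two_ne_zero]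
    positivity
  · have h0 : trunc θ 0 k = 0 := by simp [trunc, hk]
    have h1 : (1 : ℝ) ≤ |((k : ℤ) : ℝ)| := by exact_mod_cast Int.one_le_abs hk
    rw [h0, sub_zero]
    calc ‖trunc θ ℓ k‖ ^ 2 ≤ ‖θ k‖ ^ 2 := by gcongr; exact norm_trunc_le _ _ _
      _ ≤ _ := le_mul_of_one_le_left (by positivity) (one_le_rpow h1 (by linarith))

/-- The tail of a Sobolev sequence. -/
lemma sum_norm_sub_trunc_sq_le {I : Finset ℤ}
    (hI : ∑ k : I, |((k : ℤ) : ℝ)| ^ (2 * s) * ‖θ k‖ ^ 2 ≤ Q ^ 2) (hs : 1 ≤ s) {ℓ : ℕ} {ε : ℝ}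
    (hε : 0 < ε) (hℓ : 1 ≤ ε * (ℓ : ℝ) ^ s) :
    ∑ k : I, ‖θ k - trunc θ ℓ k‖ ^ 2 ≤ ε ^ 2 * Q ^ 2 := by
  calc _ ≤ ∑ k : I, ε ^ 2 * (|((k : ℤ) : ℝ)| ^ (2 * s) * ‖θ k‖ ^ 2) := by
        refine Finset.sum_le_sum fun k _ => ?_
        unfold trunc
        split_ifs with hk
        · rw [sub_self, norm_zero, zero_pow two_ne_zero]
          positivity
        · have hk' : (ℓ : ℝ) ≤ |((k : ℤ) : ℝ)| := by exact_mod_cast (not_le.1 hk).le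
          rw [sub_zero, ← mul_assoc]
          refine le_mul_of_one_le_left (by positivity) ?_
          calc (1 : ℝ) ≤ (ε * (ℓ : ℝ) ^ s) ^ 2 := one_le_pow₀ hℓ
            _ = ε ^ 2 * (ℓ : ℝ) ^ (2 * s) := by
              rw [mul_pow, mul_comm 2 s, rpow_mul (by positivity), ← rpow_natCast (_ ^ s)]
              norm_num
            _ ≤ _ := by gcongr
    _ ≤ _ := by
        rw [← Finset.mul_sum]
        gcongr

lemma sum_norm_sq_le_l2norm_sq {v : ℤ → ℂ} {ℓ : ℕ} (hv : ∀ k : ℤ, (ℓ : ℤ) < |k| → v k = 0)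
    (I : Finset ℤ) : ∑ k : I, ‖v k‖ ^ 2 ≤ l2norm v ^ 2 := by
  have hsum : Summable fun k : ℤ => ‖v k‖ ^ 2 := by
    refine summable_of_ne_finset_zero (s := Finset.Icc (-(ℓ : ℤ)) ℓ) fun k hk => ?_
    rw [hv k, norm_zero, zero_pow two_ne_zero]
    rw [Finset.mem_Icc, ← abs_le] at hk
    exact not_le.1 hk
  rw [l2norm, sq_sqrt (tsum_nonneg fun k => by positivity),
    Finset.sum_coe_sort I fun k : ℤ => ‖v k‖ ^ 2]
  exact hsum.sum_le_tsum _ fun k _ => by positivity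

/-- The Gram kernel of the centered rotation orbit is a trigonometric polynomial. -/
lemma kernel_mem_trigPoly (θ : ℤ → ℂ) (ℓ : ℕ) (I : Finset ℤ) (b : I → ℂ) :
    (fun x : ℝ => ((2 * ∑ k : I, ((rotZ (trunc θ ℓ) x k - trunc θ 0 k) *
      (starRingEnd ℂ) (b k)).re : ℝ) : ℂ)) ∈ trigPoly ℓ := by
  have h1 : (fun x : ℝ => ((2 * ∑ k : I, ((rotZ (trunc θ ℓ) x k - trunc θ 0 k) *
      (starRingEnd ℂ) (b k)).re : ℝ) : ℂ)) = ∑ k : I,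
        (((trunc θ ℓ k - trunc θ 0 k) * (starRingEnd ℂ) (b k)) • fourierMode (-k) +
          ((starRingEnd ℂ) (trunc θ ℓ k - trunc θ 0 k) * b k) • fourierMode k) := by
    ext x
    rw [Finset.sum_apply]
    push_cast
    rw [Finset.mul_sum]
    refine Finset.sum_congr rfl fun k _ => ?_
    rw [Complex.re_eq_add_conj, rotZ_trunc_sub]
    simp only [map_mul, conj_fourierMode, neg_neg, Complex.conj_conj, Pi.add_apply, Pi.smul_apply,
      smul_eq_mul]
    ring
  rw [h1]
  refine Submodule.sum_mem _ fun k _ => ?_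
  by_cases hk : |(k : ℤ)| ≤ ℓ
  · exact Submodule.add_mem _ (Submodule.smul_mem _ _ (fourierMode_mem_trigPoly (by rwa [abs_neg])))
      (Submodule.smul_mem _ _ (fourierMode_mem_trigPoly hk))
  · have hk0 : ¬ |(k : ℤ)| ≤ (0 : ℕ) := fun h => hk (h.trans (by exact_mod_cast Nat.zero_le ℓ))
    have h0 : trunc θ ℓ k - trunc θ 0 k = 0 := by
      unfold trunc
      rw [if_neg hk, if_neg hk0, sub_zero]
    simp only [h0, zero_mul, map_zero, zero_smul, add_zero, Submodule.zero_mem]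

lemma abs_kernel_le (hs : 1 ≤ s) {I : Finset ℤ}
    (hI : ∑ k : I, |((k : ℤ) : ℝ)| ^ (2 * s) * ‖θ k‖ ^ 2 ≤ Q ^ 2) (ℓ : ℕ) (x y : ℝ) :
    |2 * ∑ k : I, ((rotZ (trunc θ ℓ) x k - trunc θ 0 k) *
      (starRingEnd ℂ) (rotZ (trunc θ ℓ) y k - trunc θ 0 k)).re| ≤ 2 * Q ^ 2 := by
  rw [abs_mul, abs_two]
  refine mul_le_mul_of_nonneg_left ?_ zero_le_two
  refine (Finset.abs_sum_le_sum_abs _ _).trans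
    ((Finset.sum_le_sum fun k _ => ?_).trans (sum_norm_trunc_sub_sq_le hs hI ℓ))
  refine (Complex.abs_re_le_norm _).trans_eq ?_
  rw [rotZ_trunc_sub, rotZ_trunc_sub, norm_mul, RCLike.norm_conj, norm_mul, norm_mul,
    norm_fourierMode, norm_fourierMode]
  ring

/-- Factorials beat powers. -/
lemma pow_div_factorial_le (B : ℝ) (hB : 0 ≤ B) {ℓ : ℕ} {ε : ℝ} (hε : 0 < ε)
    (hℓ1 : 1 ≤ ℓ) (hℓ : 1 ≤ ε * (ℓ : ℝ) ^ s) :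
    B ^ ℓ / ℓ.factorial ≤ (⌈4 * s⌉₊.factorial * rexp (rexp 1 * B)) * ε ^ 4 := by
  have hℓ0 : (1 : ℝ) ≤ ℓ := by exact_mod_cast hℓ1
  have h1 : (ℓ : ℝ) ^ ⌈4 * s⌉₊ ≤ ⌈4 * s⌉₊.factorial * rexp ℓ := by
    have := Real.pow_div_factorial_le_exp (ℓ : ℝ) (by positivity) ⌈4 * s⌉₊
    exact (div_le_iff₀' (by positivity)).1 this
  have h2 : (1 : ℝ) ≤ ε ^ 4 * (ℓ : ℝ) ^ ⌈4 * s⌉₊ := by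
    calc (1 : ℝ) ≤ (ε * (ℓ : ℝ) ^ s) ^ 4 := one_le_pow₀ hℓ
      _ = ε ^ 4 * (ℓ : ℝ) ^ (4 * s) := by
        rw [mul_pow, mul_comm 4 s, rpow_mul (by positivity), ← rpow_natCast (_ ^ s)]
        norm_num
      _ ≤ ε ^ 4 * (ℓ : ℝ) ^ ⌈4 * s⌉₊ := by
        rw [← rpow_natCast (ℓ : ℝ)]
        gcongr
        exact Nat.le_ceil _
  have h3 : (rexp 1 * B) ^ ℓ / ℓ.factorial ≤ rexp (rexp 1 * B) :=
    Real.pow_div_factorial_le_exp _ (by positivity) ℓ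
  rw [mul_pow, ← Real.exp_nat_mul, mul_one] at h3
  calc B ^ ℓ / ℓ.factorial ≤ B ^ ℓ / ℓ.factorial * (ε ^ 4 * (ℓ : ℝ) ^ ⌈4 * s⌉₊) :=
        le_mul_of_one_le_right (by positivity) h2
    _ ≤ B ^ ℓ / ℓ.factorial * (ε ^ 4 * (⌈4 * s⌉₊.factorial * rexp ℓ)) := by gcongr
    _ = ⌈4 * s⌉₊.factorial * ε ^ 4 * (rexp ℓ * B ^ ℓ / ℓ.factorial) := by ring
    _ ≤ ⌈4 * s⌉₊.factorial * ε ^ 4 * rexp (rexp 1 * B) := by gcongr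
    _ = _ := by ring

end Sobolev

/-- The constant in the moment-matching estimate `sum_mul_integral_orbit_le`. -/
noncomputable def momentConst (s Q : ℝ) : ℝ :=
  2 * (⌈4 * s⌉₊.factorial * rexp (rexp 1 * (2 * Q ^ 2))) * rexp (2 * Q ^ 2) + 1 / 2

section Orbit

variable {θ : ℤ → ℂ} {s Q : ℝ}

/-- Signed measures on the orbit with vanishing low-order trigonometric moments induce Gaussian
mixtures of small total variation. -/
lemma sum_mul_integral_orbit_le (hs : 1 ≤ s) {I : Finset ℤ}
    (hI : ∑ k : I, |((k : ℤ) : ℝ)| ^ (2 * s) * ‖θ k‖ ^ 2 ≤ Q ^ 2) {ℓ : ℕ} {ε : ℝ}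
    (hε : 0 < ε) (hℓ1 : 1 ≤ ℓ) (hℓ : 1 ≤ ε * (ℓ : ℝ) ^ s) {u : (I → ℂ) → ℝ} (hu : Measurable u)
    (hu1 : ∀ z, |u z| ≤ 1) {κ : Type*} [Fintype κ] {w x : κ → ℝ} (hw : ∑ i, |w i| ≤ 2)
    (hmom : ∀ k : ℤ, |k| ≤ (ℓ * ℓ : ℕ) → ∑ i, (w i : ℂ) * fourierMode k (x i) = 0) :
    ∑ i, w i * ∫ z, u z * gaussRatio (fun k : I => trunc θ 0 k)
      (fun k : I => rotZ (trunc θ ℓ) (x i) k) z ∂gaussPi (fun k : I => trunc θ 0 k) ≤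
        momentConst s Q * ε ^ 2 := by
  have h1 := sum_mul_integral_gaussRatio_le (fun k : I => trunc θ 0 k)
    (fun i (k : I) => rotZ (trunc θ ℓ) (x i) k) w hu hu1 (pow_pos hε 2)
    (sum_sum_mul_exp_le le_rfl hmom hw
      (K := fun x y => 2 * ∑ k : I, ((rotZ (trunc θ ℓ) x k - trunc θ 0 k) *
        (starRingEnd ℂ) (rotZ (trunc θ ℓ) y k - trunc θ 0 k)).re)
      (fun y => kernel_mem_trigPoly θ ℓ I _) (abs_kernel_le hs hI ℓ))
  refine h1.trans ?_
  have h2 := pow_div_factorial_le (2 * Q ^ 2) (by positivity) hε hℓ1 hℓ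
  rw [momentConst]
  calc _ ≤ 2 ^ 2 * ((⌈4 * s⌉₊.factorial * rexp (rexp 1 * (2 * Q ^ 2))) * ε ^ 4 *
        rexp (2 * Q ^ 2)) / (2 * ε ^ 2) + ε ^ 2 / 2 := by gcongr
    _ = _ := by field_simp

lemma integral_abs_mixDensity_orbit_sub_le (hs : 1 ≤ s) (hQ : 0 ≤ Q) {I : Finset ℤ}
    (hI : ∑ k : I, |((k : ℤ) : ℝ)| ^ (2 * s) * ‖θ k‖ ^ 2 ≤ Q ^ 2) {ℓ : ℕ} {g g' : Measure ℝ}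
    [IsProbabilityMeasure g] [IsProbabilityMeasure g'] {δ : ℝ}
    (h : ∀ F : ℝ → ℝ, (∀ x y, |F x - F y| ≤ 6 * π * Q * |x - y|) → (∀ x, |F x| ≤ 1) →
      (∀ u : (I → ℂ) → ℝ, Measurable u → (∀ z, |u z| ≤ 1) →
        F = (fun x => ∫ z, u z * gaussRatio (fun k : I => trunc θ 0 k)
          (fun k : I => rotZ (trunc θ ℓ) x k) z ∂gaussPi (fun k : I => trunc θ 0 k)) →
        ∫ x, F x ∂g - ∫ x, F x ∂g' ≤ δ)) :
    ∫ z, |mixDensity (fun k : I => trunc θ 0 k) (fun φ (k : I) => rotZ (trunc θ ℓ) φ k) g z -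
      mixDensity (fun k : I => trunc θ 0 k) (fun φ (k : I) => rotZ (trunc θ ℓ) φ k) g' z|
        ∂gaussPi (fun k : I => trunc θ 0 k) ≤ δ := by
  refine integral_abs_mixDensity_sub_le _ (continuous_pi fun k => continuous_rotZ _ _) g g'
    fun u hu hu1 => h _ (fun x y => ?_)
      (fun x => abs_integral_mul_gaussRatio_le _ _ hu1) u hu hu1 rfl
  refine (abs_integral_mul_gaussRatio_sub_le _ _ _ hu hu1 (by positivity)
    (sum_norm_rotZ_trunc_sub_sq_le hs hI ℓ x y)).trans_eq ?_
  ring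

end Orbit

lemma integral_sqrt_sub_sq_le_of_chain {α : Type*} [MeasurableSpace α] {μ : Measure α}
    {a b c d : α → ℝ} (ha : Integrable a μ) (hb : Integrable b μ) (hc : Integrable c μ)
    (hd : Integrable d μ) (ha0 : 0 ≤ a) (hb0 : 0 ≤ b) (hc0 : 0 ≤ c) (hd0 : 0 ≤ d) :
    ∫ z, (√(a z) - √(d z)) ^ 2 ∂μ ≤ 3 * (∫ z, (√(a z) - √(b z)) ^ 2 ∂μ +
      ∫ z, |b z - c z| ∂μ + ∫ z, (√(c z) - √(d z)) ^ 2 ∂μ) := by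
  have hab := integrable_sqrt_sub_sq ha hb ha0 hb0
  have hcd := integrable_sqrt_sub_sq hc hd hc0 hd0
  have hbc := (hb.sub hc).abs
  simp only [Pi.sub_apply] at hbc
  have habc : Integrable (fun z => (√(a z) - √(b z)) ^ 2 + |b z - c z|) μ := hab.add hbc
  rw [← integral_add hab hbc, ← integral_add habc hcd, ← integral_const_mul]
  refine integral_mono (integrable_sqrt_sub_sq ha hd ha0 hd0)
    ((habc.add hcd).const_mul 3) fun z => ?_
  have h1 : (√(b z) - √(c z)) ^ 2 ≤ |b z - c z| := by
    rw [← sq_sqrt (hb0 z), ← sq_sqrt (hc0 z), sqrt_sq (sqrt_nonneg _), sqrt_sq (sqrt_nonneg _),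
      sq_sub_sq, abs_mul, ← sq_abs, sq, abs_of_nonneg (add_nonneg (sqrt_nonneg _) (sqrt_nonneg _))]
    refine mul_le_mul_of_nonneg_right ?_ (abs_nonneg _)
    rw [abs_le]
    constructor <;> linarith [sqrt_nonneg (b z), sqrt_nonneg (c z)]
  dsimp only [Pi.add_apply]
  nlinarith [sq_nonneg ((√(a z) - √(b z)) - (√(b z) - √(c z))),
    sq_nonneg ((√(a z) - √(b z)) - (√(c z) - √(d z))),
    sq_nonneg ((√(b z) - √(c z)) - (√(c z) - √(d z)))]

/-- description of a Hellinger neighbourhood of P_{θ⁰,g⁰}: with ℓ = ⌈ε^{−1/s}⌉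
and η = ε², there are at most Cℓ² η-separated points ψ_j and weights p_j such that any
mixture P_{θ,g} with g close to (ψ,p) in the sense Σ_j|g(ψ_j±η/2) − p_j| ≤ ε² and θ a
truncated sequence with ‖θ − θ⁰_ℓ‖ ≤ ε² satisfies d_H(P_{θ⁰,g⁰}, P_{θ,g}) ≤ C₀ε.
The constants depend only on s and Q_s. -/
theorem hellinger_neighbourhood_description :
    ∀ s : ℝ, 1 ≤ s → ∀ Qs : ℝ, 0 ≤ Qs →
      ∃ C₀ C : ℝ, 0 < C₀ ∧ 0 < C ∧ ∃ ε₀ ∈ Set.Ioo (0 : ℝ) 1,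
        ∀ θ0 : ℤ → ℂ,
          Summable (fun k : ℤ => (|k| : ℝ) ^ (2 * s) * ‖θ0 k‖ ^ 2) →
          Real.sqrt (∑' k : ℤ, (|k| : ℝ) ^ (2 * s) * ‖θ0 k‖ ^ 2) = Qs →
          ∀ g0 : Measure ℝ, IsProbOn01 g0 →
            ∀ ε ∈ Set.Ioc (0 : ℝ) ε₀, ∀ ℓ : ℕ, ℓ = ⌈ε ^ (-(1 / s))⌉₊ → ∀ η : ℝ, η = ε ^ 2 →
              ∃ (J : ℕ) (ψ : Fin J → ℝ) (p : Fin J → ℝ),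
                (J : ℝ) ≤ C * (ℓ : ℝ) ^ 2 ∧
                (∀ j, ψ j ∈ Set.Icc (0 : ℝ) 1) ∧
                (∀ i j, i ≠ j → η ≤ |ψ i - ψ j|) ∧
                (∀ j, 0 ≤ p j) ∧ (∑ j, p j) = 1 ∧
                ∀ g : Measure ℝ, IsProbOn01 g →
                  (∑ j, |(g (Set.Icc (ψ j - η / 2) (ψ j + η / 2))).toReal - p j|) ≤ ε ^ 2 →
                  ∀ θ : ℤ → ℂ, (∀ k : ℤ, (ℓ : ℤ) < |k| → θ k = 0) →
                    l2norm (fun k => θ k - trunc θ0 ℓ k) ≤ ε ^ 2 →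
                    ∀ P Q : Measure (ℤ → ℂ),
                      IsMixtureLaw θ0 g0 P → IsMixtureLaw θ g Q →
                      dH P Q ≤ C₀ * ε := by
  intro s hs Q hQ
  have hm : 0 < momentConst s Q := by unfold momentConst; positivity
  set D : ℝ := 3 * (Q ^ 2 / 2 + (18 * π * Q + momentConst s Q + 2) + 1 / 2) with hD
  have hD0 : 0 < D := by positivity
  refine ⟨√D, 7, sqrt_pos.2 hD0, by norm_num, 1 / 2, by norm_num, ?_⟩
  intro θ0 hsum hQs g0 hg0 ε hε ℓ hℓ η hη
  have hε0 : 0 < ε := hε.1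
  have hε1 : ε ≤ 1 := by linarith [hε.2]
  have hη0 : 0 < η := by rw [hη]; positivity
  have hℓε : ε ^ (-(1 / s)) ≤ ℓ := hℓ ▸ Nat.le_ceil _
  have hℓ1 : 1 ≤ ℓ := by
    have : (0 : ℝ) < ℓ := (rpow_pos_of_pos hε0 _).trans_le hℓε
    exact_mod_cast this
  have hℓs : 1 ≤ ε * (ℓ : ℝ) ^ s := by
    have h1 : (ε ^ (-(1 / s))) ^ s = ε⁻¹ := by
      rw [← rpow_mul hε0.le, neg_mul, one_div_mul_cancel (by linarith), rpow_neg_one]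
    have h2 : ε⁻¹ ≤ (ℓ : ℝ) ^ s := h1 ▸ rpow_le_rpow (by positivity) hℓε (by linarith)
    calc (1 : ℝ) = ε * ε⁻¹ := (mul_inv_cancel₀ hε0.ne').symm
      _ ≤ _ := by gcongr
  obtain ⟨J, ψ, p, hJ, hψ, hsep, hp, hp1, hquad⟩ :=
    exists_separated_quadrature hg0 (h := 2 * η) (by positivity) (ℓ * ℓ)
  refine ⟨J, ψ, p, ?_, hψ, fun i j hij => by linarith [hsep i j hij], hp, hp1, ?_⟩
  · have h1 : J ≤ 7 * ℓ ^ 2 := by nlinarith [Nat.one_le_pow 2 ℓ hℓ1]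
    exact_mod_cast h1
  intro g hg hgp θ hθ hθn P R hP hR
  have := hg0.1
  have := hg.1
  have := hP.isProbabilityMeasure
  have := hR.isProbabilityMeasure
  have hcont : ∀ (θ : ℤ → ℂ) (I : Finset ℤ), Continuous fun φ (k : I) => rotZ θ φ k :=
    fun θ I => continuous_pi fun k => continuous_rotZ θ k
  have hmarg : ∀ I : Finset ℤ,
      ∫ z, (√(mixDensity (fun k : I => trunc θ0 0 k) (fun φ (k : I) => rotZ θ0 φ k) g0 z) -
        √(mixDensity (fun k : I => trunc θ0 0 k) (fun φ (k : I) => rotZ θ φ k) g z)) ^ 2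
          ∂gaussPi (fun k : I => trunc θ0 0 k) ≤ D * ε ^ 2 := by
    intro I
    have hI := sum_sobolev_le hsum hQs I
    refine (integral_sqrt_sub_sq_le_of_chain
      (integrable_mixDensity _ (hcont θ0 I) g0) (integrable_mixDensity _ (hcont (trunc θ0 ℓ) I) g0)
      (integrable_mixDensity _ (hcont (trunc θ0 ℓ) I) g) (integrable_mixDensity _ (hcont θ I) g)
      (fun z => (mixDensity_pos _ (hcont _ I) _ z).le)
      (fun z => (mixDensity_pos _ (hcont _ I) _ z).le)
      (fun z => (mixDensity_pos _ (hcont _ I) _ z).le)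
      (fun z => (mixDensity_pos _ (hcont _ I) _ z).le)).trans ?_
    have h1 := integral_sqrt_mixDensity_sub_sq_le (fun k : I => trunc θ0 0 k) (hcont θ0 I)
      (hcont (trunc θ0 ℓ) I) g0 (r := ε ^ 2 * Q ^ 2) fun φ => by
        simp only [norm_rotZ_sub]
        exact sum_norm_sub_trunc_sq_le hI hs hε0 hℓs
    have h3 := integral_sqrt_mixDensity_sub_sq_le (fun k : I => trunc θ0 0 k)
      (hcont (trunc θ0 ℓ) I) (hcont θ I) g (r := ε ^ 2) fun φ => by
        simp only [norm_rotZ_sub, norm_sub_rev (trunc θ0 ℓ _)]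
        refine (sum_norm_sq_le_l2norm_sq (v := fun k => θ k - trunc θ0 ℓ k) (ℓ := ℓ)
          (fun k hk => ?_) I).trans ?_
        · rw [hθ k hk, trunc, if_neg (not_le.2 hk), sub_zero]
        · calc _ ≤ (ε ^ 2) ^ 2 := pow_le_pow_left₀ (sqrt_nonneg _) hθn 2
            _ ≤ ε ^ 2 := pow_le_of_le_one (by positivity) (pow_le_one₀ hε0.le hε1) two_ne_zero
    have h2 := integral_abs_mixDensity_orbit_sub_le (g := g0) (g' := g) (ℓ := ℓ)
      (δ := (18 * π * Q + momentConst s Q + 2) * ε ^ 2) hs hQ hI fun F hF hF1 u hu hu1 hFu => by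
        have h4 := hquad F (6 * π * Q) (momentConst s Q * ε ^ 2) (by positivity) hF hF1
          fun κ _ w x hw hmom => by
            rw [hFu]
            exact sum_mul_integral_orbit_le hs hI hε0 hℓ1 hℓs hu hu1 hw hmom
        have h5 := sum_sub_integral_le hη0 hsep hgp hp1 (by positivity) hF hF1
        rw [hη] at h4 h5
        linarith
    rw [hD]
    linarith
  have hfin := dH_le_of_marginals
    (T := fun (n : ℕ) (x : ℤ → ℂ) (k : Finset.Icc (-(n : ℤ)) n) => x k)
    (fun n => Finset.measurable_restrict _)
    (fun m n hmn => comap_restrict_mono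
      (Finset.Icc_subset_Icc (neg_le_neg (by exact_mod_cast hmn)) (by exact_mod_cast hmn)))
    (iSup_comap_restrict _ fun k => ⟨k.natAbs, Finset.mem_Icc.2 (by omega)⟩)
    (fun n => measurable_mixDensity _ (hcont θ0 _) g0)
    (fun n => measurable_mixDensity _ (hcont θ _) g)
    (fun n => mixDensity_pos _ (hcont θ0 _) g0) (fun n => mixDensity_pos _ (hcont θ _) g)
    (fun n => hP.map_restrict _ _) (fun n => hR.map_restrict _ _) (fun n => hmarg _)
  rwa [sqrt_mul hD0.le, sqrt_sq hε0.le] at hfin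
end

section
/- For every Borel probability measure g on [0,1] and every integer m ≥ 1, there exists a discrete probability measure g̃ on [0,1] supported on at most 2m+1 points such that ∫₀¹ e^{−i2πrφ} dg̃(φ) = ∫₀¹ e^{−i2πrφ} dg(φ) for every integer r with |r| ≤ m. -/
open MeasureTheory Real Set

/-- **Carathéodory's theorem** with a fixed number of points: in a finite-dimensional real vector
space, a point of the convex hull of `s` is a convex combination of `finrank ℝ E + 1` points
of `s`. -/
theorem exists_fin_convexCombination_of_mem_convexHull {E : Type*} [AddCommGroup E] [Module ℝ E]
    [FiniteDimensional ℝ E] {s : Set E} {x : E} (hx : x ∈ convexHull ℝ s) :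
    ∃ w ∈ stdSimplex ℝ (Fin (Module.finrank ℝ E + 1)),
      ∃ z : Fin (Module.finrank ℝ E + 1) → E, (∀ i, z i ∈ s) ∧ ∑ i, w i • z i = x := by
  classical
  obtain ⟨a, ha⟩ := convexHull_nonempty_iff.1 ⟨x, hx⟩
  obtain ⟨ι, _, z, w, hz, hind, hw, hw1, rfl⟩ := eq_pos_convex_span_of_mem_convexHull hx
  have hcard : Fintype.card ι ≤ Fintype.card (Fin (Module.finrank ℝ E + 1)) := by
    simpa using hind.card_le_finrank_succ.trans
      (Nat.add_le_add_right (Submodule.finrank_le _) 1)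
  obtain ⟨e⟩ := Function.Embedding.nonempty_of_card_le hcard
  have hout : ∀ i ∉ Set.range e, Function.extend e w 0 i = 0 := fun i hi ↦ by
    rw [Function.extend_apply' _ _ _ hi, Pi.zero_apply]
  refine ⟨Function.extend e w 0, ⟨fun i ↦ ?_, ?_⟩, Function.extend e z fun _ ↦ a, fun i ↦ ?_, ?_⟩
  · by_cases hi : i ∈ Set.range e
    · obtain ⟨j, rfl⟩ := hi
      rw [e.injective.extend_apply]
      exact (hw j).le
    · rw [hout i hi]
  · rw [← hw1]
    exact (Fintype.sum_of_injective e e.injective _ _ hout fun j ↦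
      (e.injective.extend_apply _ _ _).symm).symm
  · by_cases hi : i ∈ Set.range e
    · obtain ⟨j, rfl⟩ := hi
      rw [e.injective.extend_apply]
      exact hz ⟨j, rfl⟩
    · rwa [Function.extend_apply' _ _ _ hi]
  · refine (Fintype.sum_of_injective e e.injective _ _ (fun i hi ↦ ?_) fun j ↦ ?_).symm
    · rw [hout i hi, zero_smul]
    · rw [e.injective.extend_apply, e.injective.extend_apply]

/-- In a finite-dimensional real topological vector space, the convex hull of a compact set is
compact. -/
theorem IsCompact.convexHull_of_finiteDimensional {E : Type*} [AddCommGroup E] [Module ℝ E]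
    [TopologicalSpace E] [ContinuousAdd E] [ContinuousSMul ℝ E] [FiniteDimensional ℝ E]
    {s : Set E} (hs : IsCompact s) : IsCompact (convexHull ℝ s) := by
  have hK := (isCompact_stdSimplex ℝ (Fin (Module.finrank ℝ E + 1))).prod
    (isCompact_univ_pi fun _ : Fin (Module.finrank ℝ E + 1) ↦ hs)
  convert! hK.image (f := fun q ↦ ∑ i, q.1 i • q.2 i) (by fun_prop) using 1
  refine Set.Subset.antisymm (fun x hx ↦ ?_) ?_
  · obtain ⟨w, hw, z, hz, hx⟩ := exists_fin_convexCombination_of_mem_convexHull hx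
    exact ⟨(w, z), ⟨hw, fun i _ ↦ hz i⟩, hx⟩
  · rintro _ ⟨⟨w, z⟩, ⟨hw, hz⟩, rfl⟩
    exact (convex_convexHull ℝ s).sum_mem (fun i _ ↦ hw.1 i) hw.2
      fun i _ ↦ subset_convexHull ℝ s (hz i trivial)

/-- **Tchakaloff's theorem** for a probability measure carried by a compact set: the integral of a
continuous function with values in a finite-dimensional space `E` is a convex combination of
`finrank ℝ E + 1` of its values on that set. -/
theorem exists_fin_convexCombination_eq_integral {X E : Type*} [TopologicalSpace X]
    [MeasurableSpace X] [NormedAddCommGroup E] [NormedSpace ℝ E]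
    [FiniteDimensional ℝ E] {μ : Measure X} [IsProbabilityMeasure μ] {K : Set X}
    (hK : IsCompact K) (hμ : ∀ᵐ x ∂μ, x ∈ K) {f : X → E} (hf : ContinuousOn f K)
    (hint : Integrable f μ) :
    ∃ w ∈ stdSimplex ℝ (Fin (Module.finrank ℝ E + 1)),
      ∃ x : Fin (Module.finrank ℝ E + 1) → X, (∀ i, x i ∈ K) ∧
        ∑ i, w i • f (x i) = ∫ x, f x ∂μ := by
  have hmem : ∫ x, f x ∂μ ∈ convexHull ℝ (f '' K) :=
    (convex_convexHull ℝ _).integral_mem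
      (hK.image_of_continuousOn hf).convexHull_of_finiteDimensional.isClosed
      (hμ.mono fun x hx ↦ subset_convexHull ℝ _ ⟨x, hx, rfl⟩) hint
  obtain ⟨w, hw, z, hz, h⟩ := exists_fin_convexCombination_of_mem_convexHull hmem
  choose x hxK hxz using hz
  exact ⟨w, hw, x, hxK, by simpa only [hxz] using h⟩

theorem conj_exp_neg_I_mul_two_pi (r x : ℝ) :
    (starRingEnd ℂ) (Complex.exp (-Complex.I * (2 * Real.pi * r * x))) =
      Complex.exp (-Complex.I * (2 * Real.pi * (-r : ℝ) * x)) := by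
  rw [← Complex.exp_conj]
  simp [Complex.conj_ofNat]

theorem norm_exp_neg_I_mul_two_pi (r x : ℝ) :
    ‖Complex.exp (-Complex.I * (2 * Real.pi * r * x))‖ = 1 := by
  simpa [mul_comm] using Complex.norm_exp_I_mul_ofReal (-(2 * Real.pi * r * x))

/-- for every Borel probability measure g on [0,1] and every m ≥ 1, there is
a discrete probability measure on [0,1] supported on at most 2m+1 points whose trigonometric
moments of order |r| ≤ m agree with those of g. -/
theorem discrete_measure_matching_trig_moments
    (g : Measure ℝ) (hg : IsProbOn01 g) (m : ℕ) (hm : 1 ≤ m) :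
    ∃ (J : ℕ) (φ : Fin J → ℝ) (p : Fin J → ℝ),
      J ≤ 2 * m + 1 ∧
      (∀ j, φ j ∈ Set.Icc (0 : ℝ) 1) ∧
      (∀ j, 0 ≤ p j) ∧ (∑ j, p j) = 1 ∧
      ∀ r : ℤ, |r| ≤ (m : ℤ) →
        (∑ j, (p j : ℂ) * Complex.exp (-Complex.I * (2 * Real.pi * (r : ℝ) * φ j)))
          = ∫ φ', Complex.exp (-Complex.I * (2 * Real.pi * (r : ℝ) * φ')) ∂g := by
  obtain ⟨_, hg1⟩ := hg
  have hae : ∀ᵐ x ∂g, x ∈ Set.Icc (0 : ℝ) 1 :=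
    (prob_compl_eq_zero_iff measurableSet_Icc).2 hg1
  let f : ℝ → Fin m → ℂ := fun x k ↦
    Complex.exp (-Complex.I * (2 * Real.pi * (k + 1 : ℝ) * x))
  have hf : Continuous f := by fun_prop
  have hfi : ∀ k, Integrable (fun x ↦ f x k) g := fun k ↦
    .of_bound ((continuous_pi_iff.1 hf k).aestronglyMeasurable) 1
      (.of_forall fun x ↦ (norm_exp_neg_I_mul_two_pi (k + 1) x).le)
  have hint : Integrable f g := Integrable.of_eval hfi
  have hdim : Module.finrank ℝ (Fin m → ℂ) = 2 * m := by
    simp [Module.finrank_pi_fintype, mul_comm]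
  obtain ⟨w, hw, φ, hφ, h⟩ :=
    exists_fin_convexCombination_eq_integral isCompact_Icc hae hf.continuousOn hint
  have hpos : ∀ n : ℕ, n ≠ 0 → n ≤ m →
      (∑ j, (w j : ℂ) * Complex.exp (-Complex.I * (2 * Real.pi * (n : ℝ) * φ j)))
        = ∫ x, Complex.exp (-Complex.I * (2 * Real.pi * (n : ℝ) * x)) ∂g := by
    intro n hn hnm
    obtain ⟨k, rfl⟩ := Nat.exists_eq_succ_of_ne_zero hn
    have hk := congrFun h ⟨k, hnm⟩
    rw [eval_integral hfi] at hk
    simpa [f] using hk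
  refine ⟨_, φ, w, by rw [hdim], hφ, hw.1, hw.2, fun r hr ↦ ?_⟩
  rcases lt_trichotomy r 0 with hr0 | rfl | hr0
  · obtain ⟨n, rfl⟩ : ∃ n : ℕ, r = -n := ⟨r.natAbs, by omega⟩
    have hn := congrArg (starRingEnd ℂ) (hpos n (by omega) (by rw [abs_neg] at hr; simpa using hr))
    rw [← integral_conj, map_sum] at hn
    simp only [map_mul, Complex.conj_ofReal, conj_exp_neg_I_mul_two_pi] at hn
    simpa using hn
  · have h1 : ∑ j, (w j : ℂ) = 1 := mod_cast hw.2
    simpa using h1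
  · lift r to ℕ using hr0.le
    simpa using hpos r (by omega) (by simpa using hr)
end

section
/- Let p ≥ 1 be an integer, δ > 0, set α := 1/(2p), and let μ ∈ ℂ^p. Define the finite measures with Lebesgue densities l := (1+δ)^{−1} γ_{μ, (1+δ)^{−α} I} and u := (1+δ) γ_{μ, (1+δ)^{α} I}, where γ_{ν,tI}(x) = (πt)^{−p} e^{−‖x−ν‖²/t}. Then the squared Hellinger distance between l and u satisfies d_H(l,u)² = ∫_{ℂ^p} (√l − √u)² = δ²/(1+δ) + 2 ( 1 − 2^p √(1+δ) / (1 + (1+δ)^{1/p})^p ). Moreover there exists a universal δ₀ > 0 such that d_H(l,u)² ≤ 2δ² for every δ ∈ (0, δ₀] and every integer p ≥ 1. -/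
open MeasureTheory Real Set

/-- squared Euclidean (Hermitian) norm on ℂ^p -/
noncomputable def sqnorm (p : ℕ) (z : Fin p → ℂ) : ℝ := ∑ i, ‖z i‖ ^ 2

/-- density of the standard complex Gaussian on ℂ^p centered at μ,
with respect to Lebesgue measure on ℂ^p ≃ ℝ^{2p} -/
noncomputable def cgauss (p : ℕ) (μ z : Fin p → ℂ) : ℝ :=
  (Real.pi ^ p)⁻¹ * Real.exp (-sqnorm p (z - μ))

/-- the rotated vector θ•φ, coordinates indexed by k = i - ℓ ∈ {-ℓ,…,ℓ} -/
noncomputable def rot (ℓ : ℕ) (θ : Fin (2 * ℓ + 1) → ℂ) (φ : ℝ) : Fin (2 * ℓ + 1) → ℂ :=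
  fun i => θ i * Complex.exp (-Complex.I * (2 * Real.pi * (((i : ℤ) - (ℓ : ℤ) : ℤ) : ℝ) * φ))

/-- the H1 norm ‖θ‖_{H1} = (Σ_k k²|θ_k|²)^{1/2} -/
noncomputable def H1norm (ℓ : ℕ) (θ : Fin (2 * ℓ + 1) → ℂ) : ℝ :=
  Real.sqrt (∑ i : Fin (2 * ℓ + 1), ((((i : ℤ) - (ℓ : ℤ) : ℤ) : ℝ)) ^ 2 * ‖θ i‖ ^ 2)

/-- Hellinger distance between two (densities of) finite measures on ℂ^p -/
noncomputable def dHfin (p : ℕ) (q₁ q₂ : (Fin p → ℂ) → ℝ) : ℝ :=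
  Real.sqrt (∫ z, (Real.sqrt (q₁ z) - Real.sqrt (q₂ z)) ^ 2)

/-- density on ℂ^p of the complex Gaussian with mean ν and covariance t·Id -/
noncomputable def cgaussT (p : ℕ) (ν : Fin p → ℂ) (t : ℝ) (x : Fin p → ℂ) : ℝ :=
  ((Real.pi * t) ^ p)⁻¹ * Real.exp (-sqnorm p (x - ν) / t)

/-- the lower bracket l = (1+δ)⁻¹ γ_{μ,(1+δ)^{−α}I} with α = 1/(2p) -/
noncomputable def lowBracket (p : ℕ) (δ : ℝ) (μ : Fin p → ℂ) (x : Fin p → ℂ) : ℝ :=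
  (1 + δ)⁻¹ * cgaussT p μ ((1 + δ) ^ (-(1 / (2 * (p : ℝ))))) x

/-- the upper bracket u = (1+δ) γ_{μ,(1+δ)^{α}I} with α = 1/(2p) -/
noncomputable def upBracket (p : ℕ) (δ : ℝ) (μ : Fin p → ℂ) (x : Fin p → ℂ) : ℝ :=
  (1 + δ) * cgaussT p μ ((1 + δ) ^ (1 / (2 * (p : ℝ)))) x

theorem integral_exp_neg_mul_sqnorm_sub (p : ℕ) (μ : Fin p → ℂ) {b : ℝ} (hb : 0 < b) :
    ∫ x, Real.exp (-b * sqnorm p (x - μ)) = (π / b) ^ p := by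
  rw [integral_sub_right_eq_self (fun x => Real.exp (-b * sqnorm p x)) μ]
  have h : ∀ x : Fin p → ℂ, Real.exp (-b * sqnorm p x) = ∏ i, Real.exp (-b * ‖x i‖ ^ 2) := by
    intro x
    rw [sqnorm, Finset.mul_sum, Real.exp_sum]
  simp_rw [h]
  rw [integral_fintype_prod_volume_eq_pow (fun z : ℂ => Real.exp (-b * ‖z‖ ^ 2)),
    GaussianFourier.integral_rexp_neg_mul_sq_norm hb]
  simp

theorem integrable_exp_neg_mul_sqnorm_sub (p : ℕ) (μ : Fin p → ℂ) {b : ℝ} (hb : 0 < b) :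
    Integrable fun x => Real.exp (-b * sqnorm p (x - μ)) := by
  refine not_imp_comm.1 integral_undef ?_
  rw [integral_exp_neg_mul_sqnorm_sub p μ hb]
  positivity

/-- Squared Hellinger distance between two rescaled isotropic Gaussians with common mean and
reciprocal covariances `s⁻¹` and `s`. -/
theorem integral_sq_sqrt_sub_sqrt_cgaussT (p : ℕ) (μ : Fin p → ℂ) {r s : ℝ} (hr : 0 < r)
    (hs : 0 < s) :
    ∫ x, (√(r⁻¹ * cgaussT p μ s⁻¹ x) - √(r * cgaussT p μ s x)) ^ 2
      = r⁻¹ + r - 2 * (2 * s / (1 + s ^ 2)) ^ p := by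
  have hπ := Real.pi_pos
  have key : ∀ x : Fin p → ℂ,
      (√(r⁻¹ * cgaussT p μ s⁻¹ x) - √(r * cgaussT p μ s x)) ^ 2
        = r⁻¹ * ((π * s⁻¹) ^ p)⁻¹ * Real.exp (-s * sqnorm p (x - μ))
          + r * ((π * s) ^ p)⁻¹ * Real.exp (-s⁻¹ * sqnorm p (x - μ))
          - 2 * (π ^ p)⁻¹ * Real.exp (-((s + s⁻¹) / 2) * sqnorm p (x - μ)) := by
    intro x
    have hl : 0 ≤ r⁻¹ * cgaussT p μ s⁻¹ x := by unfold cgaussT; positivity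
    have hu : 0 ≤ r * cgaussT p μ s x := by unfold cgaussT; positivity
    have hprod : √(r⁻¹ * cgaussT p μ s⁻¹ x) * √(r * cgaussT p μ s x)
        = (π ^ p)⁻¹ * Real.exp (-((s + s⁻¹) / 2) * sqnorm p (x - μ)) := by
      rw [← Real.sqrt_mul hl, Real.sqrt_eq_iff_mul_self_eq (mul_nonneg hl hu) (by positivity)]
      have he : Real.exp (-((s + s⁻¹) / 2) * sqnorm p (x - μ))
            * Real.exp (-((s + s⁻¹) / 2) * sqnorm p (x - μ))
          = Real.exp (-sqnorm p (x - μ) / s⁻¹) * Real.exp (-sqnorm p (x - μ) / s) := by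
        rw [← Real.exp_add, ← Real.exp_add]
        congr 1
        field_simp
        ring
      rw [mul_mul_mul_comm, mul_mul_mul_comm (π ^ p)⁻¹, he]
      unfold cgaussT
      rw [mul_pow, mul_pow, inv_pow]
      field_simp
    rw [sub_sq, Real.sq_sqrt hl, Real.sq_sqrt hu, mul_assoc 2, hprod]
    have e1 : -sqnorm p (x - μ) / s⁻¹ = -s * sqnorm p (x - μ) := by field_simp
    have e2 : -sqnorm p (x - μ) / s = -s⁻¹ * sqnorm p (x - μ) := by field_simp
    unfold cgaussT
    rw [e1, e2]
    ring
  have hm : 0 < (s + s⁻¹) / 2 := by positivity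
  have hs' : 0 < s⁻¹ := inv_pos.2 hs
  simp_rw [key]
  rw [integral_sub (((integrable_exp_neg_mul_sqnorm_sub p μ hs).const_mul _).fun_add
      ((integrable_exp_neg_mul_sqnorm_sub p μ hs').const_mul _))
      ((integrable_exp_neg_mul_sqnorm_sub p μ hm).const_mul _),
    integral_add ((integrable_exp_neg_mul_sqnorm_sub p μ hs).const_mul _)
      ((integrable_exp_neg_mul_sqnorm_sub p μ hs').const_mul _),
    integral_const_mul, integral_const_mul, integral_const_mul,
    integral_exp_neg_mul_sqnorm_sub p μ hs, integral_exp_neg_mul_sqnorm_sub p μ hs',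
    integral_exp_neg_mul_sqnorm_sub p μ hm]
  have h1 : π / s = π * s⁻¹ := div_eq_mul_inv _ _
  have h2 : π / s⁻¹ = π * s := by field_simp
  have h3 : π / ((s + s⁻¹) / 2) = π * (2 * s / (1 + s ^ 2)) := by
    field_simp
    ring
  rw [h1, h2, h3, mul_pow π (2 * s / (1 + s ^ 2))]
  have hc : (π * s⁻¹) ^ p ≠ 0 := by positivity
  have hd : (π * s) ^ p ≠ 0 := by positivity
  have he : π ^ p ≠ 0 := by positivity
  rw [inv_mul_cancel_right₀ hc, inv_mul_cancel_right₀ hd, mul_assoc, inv_mul_cancel_left₀ he]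

theorem dHfin_lowBracket_upBracket_sq (p : ℕ) (μ : Fin p → ℂ) {δ : ℝ} (hδ : 0 < δ) :
    dHfin p (lowBracket p δ μ) (upBracket p δ μ) ^ 2
      = δ ^ 2 / (1 + δ) + 2 * (1 - (2 * (1 + δ) ^ (1 / (2 * (p : ℝ)))
          / (1 + ((1 + δ) ^ (1 / (2 * (p : ℝ)))) ^ 2)) ^ p) := by
  have hr : 0 < 1 + δ := by linarith
  rw [dHfin, Real.sq_sqrt (integral_nonneg fun _ => sq_nonneg _)]
  unfold lowBracket upBracket
  rw [Real.rpow_neg hr.le, integral_sq_sqrt_sub_sqrt_cgaussT p μ hr (Real.rpow_pos_of_pos hr _)]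
  field_simp
  ring

/-- The Hellinger affinity `(1 / cosh x) ^ p`, `x = log s`, is at least `1 - p * x ^ 2 / 2`. -/
theorem one_sub_le_two_mul_div_one_add_sq_pow (p : ℕ) {s : ℝ} (hs : 0 < s) :
    1 - p * Real.log s ^ 2 / 2 ≤ (2 * s / (1 + s ^ 2)) ^ p := by
  have hcosh : 2 * s / (1 + s ^ 2) = (Real.cosh (Real.log s))⁻¹ := by
    rw [Real.cosh_log hs]
    field_simp
    ring
  have hle : Real.exp (-(Real.log s ^ 2 / 2)) ≤ 2 * s / (1 + s ^ 2) := by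
    rw [hcosh, Real.exp_neg]
    exact inv_anti₀ (Real.cosh_pos _) (Real.cosh_le_exp_half_sq _)
  calc 1 - p * Real.log s ^ 2 / 2 ≤ Real.exp (p * -(Real.log s ^ 2 / 2)) := by
        have := Real.add_one_le_exp (p * -(Real.log s ^ 2 / 2))
        linarith
    _ = Real.exp (-(Real.log s ^ 2 / 2)) ^ p := Real.exp_nat_mul _ _
    _ ≤ _ := pow_le_pow_left₀ (Real.exp_pos _).le hle p

/-- exact squared Hellinger distance between the brackets l and u,
and the bound d_H(l,u)² ≤ 2δ² for δ small enough, uniformly in p. -/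
theorem hellinger_sq_between_brackets :
    (∀ (p : ℕ), 1 ≤ p → ∀ (δ : ℝ), 0 < δ → ∀ μ : Fin p → ℂ,
      dHfin p (lowBracket p δ μ) (upBracket p δ μ) ^ 2
        = δ ^ 2 / (1 + δ)
            + 2 * (1 - 2 ^ p * Real.sqrt (1 + δ)
                / (1 + (1 + δ) ^ (1 / (p : ℝ))) ^ p)) ∧
    (∃ δ₀ : ℝ, 0 < δ₀ ∧ ∀ δ ∈ Set.Ioc (0 : ℝ) δ₀, ∀ (p : ℕ), 1 ≤ p → ∀ μ : Fin p → ℂ,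
      dHfin p (lowBracket p δ μ) (upBracket p δ μ) ^ 2 ≤ 2 * δ ^ 2) := by
  refine ⟨fun p hp δ hδ μ => ?_, 1, one_pos, fun δ hδ p hp μ => ?_⟩
  · have hr : 0 < 1 + δ := by linarith
    have hp' : (p : ℝ) ≠ 0 := by positivity
    have h1 : ((1 + δ) ^ (1 / (2 * (p : ℝ)))) ^ p = √(1 + δ) := by
      rw [← Real.rpow_mul_natCast hr.le, Real.sqrt_eq_rpow]
      congr 1
      field_simp
    have h2 : ((1 + δ) ^ (1 / (2 * (p : ℝ)))) ^ 2 = (1 + δ) ^ (1 / (p : ℝ)) := by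
      rw [← Real.rpow_mul_natCast hr.le]
      congr 1
      push_cast
      field_simp
    rw [dHfin_lowBracket_upBracket_sq p μ hδ, div_pow, mul_pow, h1, h2]
  · have hδ0 := hδ.1
    have hr : 0 < 1 + δ := by linarith
    have hp1 : (1 : ℝ) ≤ p := by exact_mod_cast hp
    rw [dHfin_lowBracket_upBracket_sq p μ hδ0]
    have haff := one_sub_le_two_mul_div_one_add_sq_pow p
      (Real.rpow_pos_of_pos hr (1 / (2 * (p : ℝ))))
    rw [Real.log_rpow hr] at haff
    have hlog0 : 0 ≤ Real.log (1 + δ) := Real.log_nonneg (by linarith)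
    have hlog : Real.log (1 + δ) ^ 2 ≤ δ ^ 2 := by
      have := Real.log_le_sub_one_of_pos hr
      exact pow_le_pow_left₀ hlog0 (by linarith) 2
    have hexp : p * (1 / (2 * (p : ℝ)) * Real.log (1 + δ)) ^ 2 / 2 ≤ δ ^ 2 / 2 := by
      have : p * (1 / (2 * (p : ℝ)) * Real.log (1 + δ)) ^ 2 / 2
          = Real.log (1 + δ) ^ 2 / (8 * p) := by
        field_simp
        ring
      rw [this]
      exact div_le_div₀ (sq_nonneg _) hlog (by norm_num) (by linarith)
    have hdiv : δ ^ 2 / (1 + δ) ≤ δ ^ 2 := div_le_self (sq_nonneg _) (by linarith)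
    linarith
end
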